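/- Let f : (0,∞) → ℂ be locally absolutely continuous, of bounded variation on (0,∞), with lim_{t→∞} f(t) = 0 (so that its derivative f' is Lebesgue integrable on (0,∞)). Suppose in addition that the T-transform Tf' is Lebesgue integrable on (0,∞). Then the cosine Fourier transform f̂_c(x) = ∫_0^∞ f(t) cos(xt) dt is Lebesgue integrable on (0,∞), and there is an absolute constant C > 0 such that ‖f̂_c‖_{L^1(0,∞)} ≤ C (‖f'‖_{L^1(0,∞)} + ‖Tf'‖_{L^1(0,∞)}). -/

import Mathlib

open MeasureTheory Filter Set Real

section Hardy

/-- A Schur-type bound for the rows of the Hilbert matrix. -/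
lemma sum_hilbert_row_le (i N : ℕ) :
    ∑ j ∈ Finset.range N, 1 / ((i : ℝ) + j + 1) * (√(i + 1) / √(j + 1)) ≤ 8 := by
  set q : ℝ := √((i : ℝ) + 1) with hq
  have hq1 : 1 ≤ q := by
    rw [hq]; exact Real.one_le_sqrt.2 (by linarith [(Nat.cast_nonneg i : (0 : ℝ) ≤ i)])
  have hqq : q ^ 2 = i + 1 := Real.sq_sqrt (by positivity)
  have key : ∀ j : ℕ, 1 / ((i : ℝ) + j + 1) * (q / √(j + 1)) ≤
      8 * q / (q + √j) - 8 * q / (q + √((j + 1 : ℕ) : ℝ)) := by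
    intro j
    set s : ℝ := √(j : ℝ) with hs
    set t : ℝ := √((j : ℝ) + 1) with ht
    have hs0 : 0 ≤ s := Real.sqrt_nonneg _
    have hss : s ^ 2 = j := Real.sq_sqrt (by positivity)
    have htt : t ^ 2 = j + 1 := Real.sq_sqrt (by positivity)
    have ht0 : 0 < t := Real.sqrt_pos.2 (by positivity)
    have hst : s ≤ t := Real.sqrt_le_sqrt (by linarith)
    have e1 : (i : ℝ) + j + 1 = q ^ 2 + s ^ 2 := by rw [hqq, hss]; ring
    have e2 : (((j + 1 : ℕ) : ℝ)) = (j : ℝ) + 1 := by push_cast; ring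
    rw [e1, e2, ← ht]
    have e3 : 8 * q / (q + s) - 8 * q / (q + t) = 8 * q * (t - s) / ((q + s) * (q + t)) := by
      field_simp; ring
    have e4 : (t - s) * (t + s) = 1 := by nlinarith
    have e5 : 1 ≤ 2 * t * (t - s) := by nlinarith
    rw [e3, one_div_mul_eq_div, div_div, div_le_div_iff₀ (by positivity) (by positivity)]
    have hb : (q + s) * (q + t) ≤ 4 * (q ^ 2 + s ^ 2) := by
      nlinarith [sq_nonneg (q - t), sq_nonneg (q - s), sq_nonneg (s - t)]
    calc q * ((q + s) * (q + t)) ≤ q * (4 * (q ^ 2 + s ^ 2)) := by gcongr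
      _ = 4 * q * (q ^ 2 + s ^ 2) * 1 := by ring
      _ ≤ 4 * q * (q ^ 2 + s ^ 2) * (2 * t * (t - s)) := by gcongr
      _ = _ := by ring
  calc _ ≤ ∑ j ∈ Finset.range N, (8 * q / (q + √j) - 8 * q / (q + √((j + 1 : ℕ) : ℝ))) :=
        Finset.sum_le_sum fun j _ => key j
    _ = 8 * q / (q + √((0 : ℕ) : ℝ)) - 8 * q / (q + √(N : ℝ)) :=
        Finset.sum_range_sub' (fun j : ℕ => 8 * q / (q + √(j : ℝ))) N
    _ ≤ 8 * q / (q + √((0 : ℕ) : ℝ)) := sub_le_self _ (by positivity)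
    _ = 8 := by simp; field_simp

/-- Hilbert's inequality in additive form. -/
lemma sum_sum_div_le (a b : ℕ → ℝ) (N : ℕ) :
    ∑ i ∈ Finset.range N, ∑ j ∈ Finset.range N, a i * b j / ((i : ℝ) + j + 1) ≤
      4 * (∑ i ∈ Finset.range N, a i ^ 2 + ∑ j ∈ Finset.range N, b j ^ 2) := by
  have key : ∀ i j : ℕ, a i * b j / ((i : ℝ) + j + 1) ≤
      a i ^ 2 / 2 * (1 / ((i : ℝ) + j + 1) * (√(i + 1) / √(j + 1))) +
      b j ^ 2 / 2 * (1 / ((j : ℝ) + i + 1) * (√(j + 1) / √(i + 1))) := by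
    intro i j
    set s : ℝ := √((i : ℝ) + 1)
    set t : ℝ := √((j : ℝ) + 1)
    have hs : 0 < s := Real.sqrt_pos.2 (by positivity)
    have ht : 0 < t := Real.sqrt_pos.2 (by positivity)
    have hd : 0 < (i : ℝ) + j + 1 := by positivity
    have e : (j : ℝ) + i + 1 = i + j + 1 := by ring
    rw [e]
    have : a i ^ 2 / 2 * (1 / ((i : ℝ) + j + 1) * (s / t)) +
      b j ^ 2 / 2 * (1 / ((i : ℝ) + j + 1) * (t / s)) - a i * b j / ((i : ℝ) + j + 1) =
      (a i * s - b j * t) ^ 2 / (2 * ((i : ℝ) + j + 1) * s * t) := by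
      field_simp; ring
    have h2 : 0 ≤ (a i * s - b j * t) ^ 2 / (2 * ((i : ℝ) + j + 1) * s * t) := by positivity
    linarith
  calc _ ≤ ∑ i ∈ Finset.range N, ∑ j ∈ Finset.range N,
      (a i ^ 2 / 2 * (1 / ((i : ℝ) + j + 1) * (√(i + 1) / √(j + 1))) +
      b j ^ 2 / 2 * (1 / ((j : ℝ) + i + 1) * (√(j + 1) / √(i + 1)))) :=
        Finset.sum_le_sum fun i _ => Finset.sum_le_sum fun j _ => key i j
    _ = ∑ i ∈ Finset.range N, a i ^ 2 / 2 *
          (∑ j ∈ Finset.range N, 1 / ((i : ℝ) + j + 1) * (√(i + 1) / √(j + 1))) +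
        ∑ j ∈ Finset.range N, b j ^ 2 / 2 *
          (∑ i ∈ Finset.range N, 1 / ((j : ℝ) + i + 1) * (√(j + 1) / √(i + 1))) := by
        simp_rw [Finset.sum_add_distrib, Finset.mul_sum]
        congr 1
        exact Finset.sum_comm
    _ ≤ ∑ i ∈ Finset.range N, a i ^ 2 / 2 * 8 + ∑ j ∈ Finset.range N, b j ^ 2 / 2 * 8 := by
        gcongr
        · exact sum_hilbert_row_le _ _
        · exact sum_hilbert_row_le _ _
    _ = _ := by rw [← Finset.sum_mul, ← Finset.sum_mul, ← Finset.sum_div, ← Finset.sum_div]; ring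

/-- The `n`-th Taylor coefficient at the origin. -/
noncomputable def taylorCoeffZero (u : ℂ → ℂ) (n : ℕ) : ℂ := iteratedDeriv n u 0 / n.factorial

lemma taylorCoeffZero_mul {u v : ℂ → ℂ} (hu : DiffContOnCl ℂ u (Metric.ball 0 1))
    (hv : DiffContOnCl ℂ v (Metric.ball 0 1)) (n : ℕ) :
    taylorCoeffZero (u * v) n =
      ∑ i ∈ Finset.range (n + 1), taylorCoeffZero u i * taylorCoeffZero v (n - i) := by
  have h0 : (0 : ℂ) ∈ Metric.ball (0 : ℂ) 1 := by simp
  have cu : ContDiffAt ℂ n u 0 :=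
    (hu.differentiableOn.analyticAt (Metric.isOpen_ball.mem_nhds h0)).contDiffAt
  have cv : ContDiffAt ℂ n v 0 :=
    (hv.differentiableOn.analyticAt (Metric.isOpen_ball.mem_nhds h0)).contDiffAt
  unfold taylorCoeffZero
  rw [iteratedDeriv_mul cu cv, Finset.sum_div]
  refine Finset.sum_congr rfl fun i hi => ?_
  have hi' : i ≤ n := Nat.lt_succ_iff.1 (Finset.mem_range.1 hi)
  have h := Nat.choose_mul_factorial_mul_factorial hi'
  have h' : (n.factorial : ℂ) = n.choose i * i.factorial * (n - i).factorial := by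
    exact_mod_cast h.symm
  have h1 : (i.factorial : ℂ) ≠ 0 := by exact_mod_cast i.factorial_ne_zero
  have h2 : ((n - i).factorial : ℂ) ≠ 0 := by exact_mod_cast (n - i).factorial_ne_zero
  have h3 : (n.choose i : ℂ) ≠ 0 := by exact_mod_cast (Nat.choose_pos hi').ne'
  rw [h']
  field_simp

lemma taylorCoeffZero_eval (p : Polynomial ℂ) (n : ℕ) :
    taylorCoeffZero (fun z => p.eval z) n = p.coeff n := by
  have h : ∀ (n : ℕ) (p : Polynomial ℂ), iteratedDeriv n (fun z => p.eval z) =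
      fun z => (Polynomial.derivative^[n] p).eval z := by
    intro n
    induction n with
    | zero => intro p; simp
    | succ n ih =>
      intro p
      rw [iteratedDeriv_succ']
      have : deriv (fun z => p.eval z) = fun z => p.derivative.eval z := by
        funext z; exact p.deriv
      rw [this, ih]; rfl
  unfold taylorCoeffZero
  rw [h]
  simp only [← Polynomial.coeff_zero_eq_eval_zero, Polynomial.coeff_iterate_derivative]
  have : (n.factorial : ℂ) ≠ 0 := by exact_mod_cast n.factorial_ne_zero
  simp [Nat.descFactorial_self]
  field_simp

lemma DiffContOnCl.continuous_comp_circleMap {u : ℂ → ℂ}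
    (hu : DiffContOnCl ℂ u (Metric.ball 0 1)) : Continuous fun θ : ℝ => u (circleMap 0 1 θ) := by
  refine hu.continuousOn_ball.comp_continuous (continuous_circleMap 0 1) fun θ => ?_
  exact circleMap_mem_closedBall 0 zero_le_one θ

/-- Bessel's inequality for Taylor coefficients. -/
lemma sum_norm_taylorCoeffZero_sq_le {u : ℂ → ℂ} (hu : DiffContOnCl ℂ u (Metric.ball 0 1))
    (N : ℕ) : ∑ n ∈ Finset.range N, ‖taylorCoeffZero u n‖ ^ 2 ≤
      (2 * π)⁻¹ * ∫ θ in (0 : ℝ)..2 * π, ‖u (circleMap 0 1 θ)‖ ^ 2 := by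
  have hcont := hu.continuous_comp_circleMap
  have hL2 : MemLp (fun θ : ℝ => u (circleMap 0 1 θ)) 2 (volume.restrict (Ioc 0 (2 * π))) := by
    obtain ⟨M, hM⟩ := isCompact_Icc.exists_bound_of_continuousOn
      (hcont.continuousOn (s := Icc 0 (2 * π)))
    refine MemLp.of_bound hcont.aestronglyMeasurable M ?_
    exact (ae_restrict_mem measurableSet_Ioc).mono fun θ hθ => hM θ (Ioc_subset_Icc_self hθ)
  have hs := hasSum_sq_fourierCoeffOn Real.two_pi_pos hL2
  have hcoef : ∀ n : ℕ, fourierCoeffOn Real.two_pi_pos (fun θ : ℝ => u (circleMap 0 1 θ)) n =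
      taylorCoeffZero u n := by
    intro n
    have h := hu.circleIntegral_one_div_sub_center_pow_smul one_pos n
    rw [fourierCoeffOn_eq_integral]
    have hI : ∮ z in C(0, 1), (1 / (z - 0) ^ (n + 1)) • u z =
        Complex.I * ∫ x in (0 : ℝ)..2 * π,
          fourier (-(n : ℤ)) (x : AddCircle (2 * π - 0)) • u (circleMap 0 1 x) := by
      rw [circleIntegral, ← intervalIntegral.integral_const_mul]
      refine intervalIntegral.integral_congr fun x _ => ?_
      simp only [deriv_circleMap, sub_zero, smul_eq_mul, fourier_coe_apply]
      have e1 : circleMap 0 1 x ≠ 0 := circleMap_ne_center one_ne_zero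
      have e2 : Complex.exp (2 * π * Complex.I * ((-(n : ℤ) : ℤ) : ℂ) * x / ((2 * π : ℝ) : ℂ)) =
          (circleMap 0 1 x ^ n)⁻¹ := by
        rw [circleMap_zero, Complex.ofReal_one, one_mul, ← Complex.exp_nat_mul, ← Complex.exp_neg]
        congr 1
        have : (π : ℂ) ≠ 0 := by exact_mod_cast Real.pi_ne_zero
        push_cast
        field_simp
      rw [e2]
      field_simp
      ring
    rw [hI] at h
    unfold taylorCoeffZero
    have hI0 := Complex.I_ne_zero
    have hπ : (π : ℂ) ≠ 0 := by exact_mod_cast Real.pi_ne_zero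
    have h4 : (∫ x in (0 : ℝ)..2 * π,
          fourier (-(n : ℤ)) (x : AddCircle (2 * π - 0)) • u (circleMap 0 1 x)) =
          (2 * π / n.factorial) * iteratedDeriv n u 0 := by
      apply mul_left_cancel₀ hI0
      rw [h, smul_eq_mul]; ring
    rw [h4]
    rw [Complex.real_smul]
    push_cast
    rw [sub_zero]
    field_simp
  have h1 : ∑ n ∈ Finset.range N, ‖taylorCoeffZero u n‖ ^ 2 =
      ∑ i ∈ (Finset.range N).map Nat.castEmbedding,
        ‖fourierCoeffOn Real.two_pi_pos (fun θ : ℝ => u (circleMap 0 1 θ)) i‖ ^ 2 := by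
    rw [Finset.sum_map]
    refine Finset.sum_congr rfl fun n _ => ?_
    rw [← hcoef n]; rfl
  rw [h1]
  have := sum_le_hasSum ((Finset.range N).map Nat.castEmbedding) (fun i _ => by positivity) hs
  simpa using this

/-- `p` is a product of two disc functions, each having modulus `|p| ^ (1 / 2)` on the circle. -/
def HasBalancedFactorization (p : ℂ → ℂ) : Prop :=
  ∃ u v : ℂ → ℂ, DiffContOnCl ℂ u (Metric.ball 0 1) ∧ DiffContOnCl ℂ v (Metric.ball 0 1) ∧
    (∀ z, ‖z‖ < 1 → p z = u z * v z) ∧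
    ∀ z, ‖z‖ = 1 → ‖u z‖ ^ 2 = ‖p z‖ ∧ ‖v z‖ ^ 2 = ‖p z‖

lemma HasBalancedFactorization.mul {p q : ℂ → ℂ} (hp : HasBalancedFactorization p)
    (hq : HasBalancedFactorization q) : HasBalancedFactorization fun z => p z * q z := by
  obtain ⟨u, v, hu, hv, h, h'⟩ := hp
  obtain ⟨u₁, v₁, hu₁, hv₁, h₁, h₁'⟩ := hq
  refine ⟨fun z => u z * u₁ z, fun z => v z * v₁ z, hu.smul hu₁, hv.smul hv₁, ?_, ?_⟩
  · intro z hz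
    simp only [h z hz, h₁ z hz]; ring
  · intro z hz
    simp only [norm_mul, mul_pow, h' z hz, h₁' z hz, and_self]

lemma hasBalancedFactorization_const (c : ℂ) : HasBalancedFactorization fun _ => c := by
  have hc : (c ^ (2⁻¹ : ℂ)) ^ 2 = c := by
    simp
  have hn : ‖c ^ (2⁻¹ : ℂ)‖ ^ 2 = ‖c‖ := by rw [← norm_pow, hc]
  refine ⟨fun _ => c ^ (2⁻¹ : ℂ), fun _ => c ^ (2⁻¹ : ℂ), diffContOnCl_const, diffContOnCl_const,
    fun z _ => by rw [← sq, hc], fun z _ => ⟨hn, hn⟩⟩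

lemma diffContOnCl_sqrt_one_sub {β : ℂ} (hβ : ‖β‖ ≤ 1) :
    DiffContOnCl ℂ (fun z => (1 - β * z) ^ (2⁻¹ : ℂ)) (Metric.ball 0 1) := by
  have hn : ∀ z : ℂ, (β * z).re ≤ ‖z‖ := fun z =>
    (Complex.re_le_norm _).trans (by
      rw [norm_mul]; exact mul_le_of_le_one_left (norm_nonneg _) hβ)
  refine DiffContOnCl.mk_ball ?_ ?_
  · intro z hz
    have hz' : ‖z‖ < 1 := by simpa using hz
    have hm : 1 - β * z ∈ Complex.slitPlane := by
      left
      have := hn z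
      simp only [Complex.sub_re, Complex.one_re]
      linarith
    have hd : DifferentiableAt ℂ (fun z => 1 - β * z) z := by fun_prop
    exact (hd.cpow (differentiableAt_const _) hm).differentiableWithinAt
  · intro z hz
    have hz' : ‖z‖ ≤ 1 := by simpa using hz
    have hre : 0 ≤ (1 - β * z).re := by
      have := hn z
      simp only [Complex.sub_re, Complex.one_re]
      linarith
    have hc : ContinuousAt (fun w : ℂ => w ^ (2⁻¹ : ℂ)) (1 - β * z) := by
      by_cases h0 : 1 - β * z = 0
      · rw [h0]
        have h := Complex.continuousAt_cpow_zero_of_re_pos (z := (2⁻¹ : ℂ)) (by norm_num)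
        exact ContinuousAt.comp (f := fun w : ℂ => (w, (2⁻¹ : ℂ))) h (by fun_prop)
      · apply continuousAt_cpow_const
        rcases hre.lt_or_eq with h | h
        · exact Or.inl h
        · refine Or.inr fun him => h0 (Complex.ext h.symm him)
    exact (ContinuousAt.comp (f := fun z : ℂ => 1 - β * z) hc (by fun_prop)).continuousWithinAt

lemma hasBalancedFactorization_one_sub {β : ℂ} (hβ : ‖β‖ ≤ 1) :
    HasBalancedFactorization fun z => 1 - β * z := by
  have hc : ∀ z : ℂ, ((1 - β * z) ^ (2⁻¹ : ℂ)) ^ 2 = 1 - β * z := fun z => by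
    simp
  have hn : ∀ z : ℂ, ‖(1 - β * z) ^ (2⁻¹ : ℂ)‖ ^ 2 = ‖1 - β * z‖ := fun z => by
    rw [← norm_pow, hc]
  exact ⟨_, _, diffContOnCl_sqrt_one_sub hβ, diffContOnCl_sqrt_one_sub hβ,
    fun z _ => by rw [← sq, hc], fun z _ => ⟨hn z, hn z⟩⟩

lemma hasBalancedFactorization_sub (α : ℂ) : HasBalancedFactorization fun z => z - α := by
  rcases le_or_gt 1 ‖α‖ with h | h
  · have h0 : α ≠ 0 := by rintro rfl; simp at h; linarith
    have := (hasBalancedFactorization_const (-α)).mul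
      (hasBalancedFactorization_one_sub (β := α⁻¹) (by rw [norm_inv]; exact inv_le_one_of_one_le₀ h))
    convert this using 2 with z
    field_simp; ring
  · obtain ⟨u, v, hu, hv, hm, hn⟩ :=
      hasBalancedFactorization_one_sub (β := (starRingEnd ℂ) α) (by simpa using h.le)
    have hne : ∀ z : ℂ, ‖z‖ ≤ 1 → 1 - (starRingEnd ℂ) α * z ≠ 0 := by
      intro z hz h0
      have : ‖(starRingEnd ℂ) α * z‖ = 1 := by rw [← sub_eq_zero.1 h0, norm_one]
      rw [norm_mul, RCLike.norm_conj] at this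
      nlinarith [norm_nonneg α, norm_nonneg z]
    have hd : DiffContOnCl ℂ (fun z : ℂ => (z - α) * (1 - (starRingEnd ℂ) α * z)⁻¹)
        (Metric.ball 0 1) := by
      apply DifferentiableOn.diffContOnCl
      rw [closure_ball _ one_ne_zero]
      intro z hz
      have := hne z (by simpa using hz)
      exact DifferentiableAt.differentiableWithinAt (by fun_prop (disch := assumption))
    have hnorm : ∀ z : ℂ, ‖z‖ = 1 → ‖z - α‖ = ‖1 - (starRingEnd ℂ) α * z‖ := by
      intro z hz
      have hz2 : z * (starRingEnd ℂ) z = 1 := by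
        rw [Complex.mul_conj, Complex.normSq_eq_norm_sq, hz]; norm_num
      have : 1 - (starRingEnd ℂ) α * z = z * (starRingEnd ℂ) (z - α) := by
        rw [map_sub, mul_sub, hz2]; ring
      rw [this, norm_mul, hz, one_mul, RCLike.norm_conj]
    refine ⟨fun z => ((z - α) * (1 - (starRingEnd ℂ) α * z)⁻¹) * u z, v, hd.smul hu, hv, ?_, ?_⟩
    · intro z hz
      have h1 := hne z hz.le
      have h2 := hm z hz
      rw [mul_assoc, ← h2, mul_assoc, inv_mul_cancel₀ h1, mul_one]
    · intro z hz
      have h1 : ‖1 - (starRingEnd ℂ) α * z‖ ≠ 0 := norm_ne_zero_iff.2 (hne z hz.le)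
      obtain ⟨h3, h4⟩ := hn z hz
      refine ⟨?_, by rw [h4, hnorm z hz]⟩
      rw [norm_mul, norm_mul, norm_inv, hnorm z hz, mul_inv_cancel₀ h1, one_mul, h3]

lemma hasBalancedFactorization_polynomial (p : Polynomial ℂ) :
    HasBalancedFactorization fun z => p.eval z := by
  have hs := IsAlgClosed.splits p
  have h : (fun z => p.eval z) = fun z => p.leadingCoeff * (p.roots.map fun a => z - a).prod := by
    funext z; exact hs.eval_eq_prod_roots z
  rw [h]
  refine (hasBalancedFactorization_const _).mul ?_
  induction p.roots using Multiset.induction_on with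
  | empty => simpa using hasBalancedFactorization_const 1
  | cons a s ih => simpa using (hasBalancedFactorization_sub a).mul ih

/-- **Hardy's inequality** for polynomials. -/
theorem sum_norm_coeff_div_le (p : Polynomial ℂ) (N : ℕ) :
    ∑ n ∈ Finset.range N, ‖p.coeff n‖ / (n + 1) ≤
      8 * (2 * π)⁻¹ * ∫ θ in (0 : ℝ)..2 * π, ‖p.eval (circleMap 0 1 θ)‖ := by
  obtain ⟨u, v, hu, hv, hm, hn⟩ := hasBalancedFactorization_polynomial p
  have hev : (fun z => p.eval z) =ᶠ[nhds 0] u * v := by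
    filter_upwards [Metric.ball_mem_nhds (0 : ℂ) one_pos] with z hz
    exact hm z (by simpa using hz)
  have hcoef : ∀ n, ‖p.coeff n‖ ≤ ∑ i ∈ Finset.range (n + 1),
      ‖taylorCoeffZero u i‖ * ‖taylorCoeffZero v (n - i)‖ := by
    intro n
    have : p.coeff n = taylorCoeffZero (u * v) n := by
      rw [← taylorCoeffZero_eval, taylorCoeffZero, taylorCoeffZero, hev.iteratedDeriv_eq n]
    rw [this, taylorCoeffZero_mul hu hv]
    refine (norm_sum_le _ _).trans (le_of_eq ?_)
    simp only [norm_mul]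
  set a : ℕ → ℝ := fun i => ‖taylorCoeffZero u i‖
  set b : ℕ → ℝ := fun i => ‖taylorCoeffZero v i‖
  have h1 : ∑ n ∈ Finset.range N, ‖p.coeff n‖ / (n + 1) ≤
      ∑ i ∈ Finset.range N, ∑ j ∈ Finset.range N, a i * b j / ((i : ℝ) + j + 1) := by
    calc _ ≤ ∑ n ∈ Finset.range N, ∑ i ∈ Finset.range (n + 1),
          a i * b (n - i) / ((i : ℝ) + (n - i : ℕ) + 1) := by
          refine Finset.sum_le_sum fun n _ => ?_
          calc _ ≤ (∑ i ∈ Finset.range (n + 1), a i * b (n - i)) / ((n : ℝ) + 1) := by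
                gcongr; exact hcoef n
            _ = _ := by
                rw [Finset.sum_div]
                refine Finset.sum_congr rfl fun i hi => ?_
                have : i ≤ n := Nat.lt_succ_iff.1 (Finset.mem_range.1 hi)
                rw [Nat.cast_sub this]; ring_nf
      _ = ∑ m ∈ Finset.range N, ∑ k ∈ Finset.range (N - m), a m * b k / ((m : ℝ) + k + 1) :=
          Finset.sum_range_diag_flip N fun m k => a m * b k / ((m : ℝ) + k + 1)
      _ ≤ _ := by
          refine Finset.sum_le_sum fun i _ => ?_
          refine Finset.sum_le_sum_of_subset_of_nonneg (Finset.range_mono (Nat.sub_le _ _)) ?_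
          intros; positivity
  have hI : ∀ w : ℂ → ℂ, (∀ z, ‖z‖ = 1 → ‖w z‖ ^ 2 = ‖p.eval z‖) →
      ∫ θ in (0 : ℝ)..2 * π, ‖w (circleMap 0 1 θ)‖ ^ 2 =
        ∫ θ in (0 : ℝ)..2 * π, ‖p.eval (circleMap 0 1 θ)‖ := fun w hw =>
    intervalIntegral.integral_congr fun θ _ => hw _ (by simp)
  have h2 := sum_norm_taylorCoeffZero_sq_le hu N
  have h3 := sum_norm_taylorCoeffZero_sq_le hv N
  rw [hI u fun z hz => (hn z hz).1] at h2
  rw [hI v fun z hz => (hn z hz).2] at h3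
  have h4 := sum_sum_div_le a b N
  linarith

end Hardy

section Transference

/-- The Fourier integral `∫ F(t) e^{-iξt} dt`. -/
noncomputable def fourierInt (F : ℝ → ℂ) (ξ : ℝ) : ℂ :=
  ∫ t, F t * Complex.exp (-(ξ * t : ℝ) * Complex.I)

lemma integrable_mul_exp {F : ℝ → ℂ} (hF : Integrable F) (ξ : ℝ) :
    Integrable fun t => F t * Complex.exp (-(ξ * t : ℝ) * Complex.I) := by
  refine hF.mul_bdd (c := 1) (by fun_prop) (Eventually.of_forall fun t => ?_)
  rw [← Complex.ofReal_neg, Complex.norm_exp_ofReal_mul_I]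

lemma continuous_fourierInt {F : ℝ → ℂ} (hF : Integrable F) : Continuous (fourierInt F) := by
  refine continuous_of_dominated (bound := fun t => ‖F t‖)
    (fun ξ => (integrable_mul_exp hF ξ).aestronglyMeasurable) ?_ hF.norm ?_
  · intro ξ
    refine Eventually.of_forall fun t => ?_
    rw [norm_mul, ← Complex.ofReal_neg, Complex.norm_exp_ofReal_mul_I, mul_one]
  · exact Eventually.of_forall fun t => by fun_prop

/-- The Dirichlet-type sum whose squared modulus is a multiple of the Fejér kernel. -/
noncomputable def expSum (N : ℕ) (φ : ℝ) : ℂ :=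
  ∑ k ∈ Finset.range N, Complex.exp ((k * φ : ℝ) * Complex.I)

lemma norm_expSum_le (N : ℕ) (φ : ℝ) : ‖expSum N φ‖ ≤ N := by
  refine (norm_sum_le _ _).trans ?_
  simp [Complex.norm_exp_ofReal_mul_I, -Complex.ofReal_mul]

lemma continuous_expSum (N : ℕ) : Continuous (expSum N) := by
  unfold expSum; fun_prop

lemma norm_expSum_sq (N : ℕ) (φ : ℝ) : ((‖expSum N φ‖ ^ 2 : ℝ) : ℂ) =
    ∑ j ∈ Finset.range N, ∑ k ∈ Finset.range N,
      Complex.exp ((((j : ℤ) - (k : ℤ) : ℤ) * φ : ℝ) * Complex.I) := by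
  rw [← Complex.normSq_eq_norm_sq, ← Complex.mul_conj, expSum, map_sum, Finset.sum_mul_sum]
  refine Finset.sum_congr rfl fun j _ => Finset.sum_congr rfl fun k _ => ?_
  rw [← Complex.exp_conj, ← Complex.exp_add]
  congr 1
  simp
  ring

lemma integral_norm_expSum_sq (N : ℕ) (c : ℝ) :
    ∫ θ in (0 : ℝ)..2 * π, ‖expSum N (θ - c)‖ ^ 2 = 2 * π * N := by
  have h : ((∫ θ in (0 : ℝ)..2 * π, ‖expSum N (θ - c)‖ ^ 2 : ℝ) : ℂ) = ((2 * π * N : ℝ) : ℂ) := by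
    rw [← intervalIntegral.integral_ofReal]
    simp_rw [norm_expSum_sq]
    rw [intervalIntegral.integral_finsetSum
      (fun j _ => Continuous.intervalIntegrable (by fun_prop) _ _)]
    have h1 : ∀ j ∈ Finset.range N, ∫ θ in (0 : ℝ)..2 * π, ∑ k ∈ Finset.range N,
        Complex.exp ((((j : ℤ) - (k : ℤ) : ℤ) * (θ - c) : ℝ) * Complex.I) = 2 * π := by
      intro j hj
      rw [intervalIntegral.integral_finsetSum
        (fun k _ => Continuous.intervalIntegrable (by fun_prop) _ _)]
      rw [Finset.sum_eq_single j]
      · simp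
      · intro k _ hkj
        have hm : ((j : ℤ) - (k : ℤ) : ℤ) ≠ 0 := sub_ne_zero.2 (by exact_mod_cast hkj.symm)
        generalize ((j : ℤ) - (k : ℤ) : ℤ) = m at hm
        have hm' : (m : ℂ) * Complex.I ≠ 0 :=
          mul_ne_zero (by exact_mod_cast hm) Complex.I_ne_zero
        have e : ∀ θ : ℝ, Complex.exp ((m * (θ - c) : ℝ) * Complex.I) =
            Complex.exp (-(m * c) * Complex.I) * Complex.exp (m * Complex.I * θ) := by
          intro θ
          rw [← Complex.exp_add]; congr 1; push_cast; ring
        simp_rw [e]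
        rw [intervalIntegral.integral_const_mul, integral_exp_mul_complex hm']
        have : Complex.exp (m * Complex.I * ((2 * π : ℝ) : ℂ)) = 1 := by
          rw [Complex.exp_eq_one_iff]; exact ⟨m, by push_cast; ring⟩
        rw [this]; simp
      · intro h; exact absurd hj h
    rw [Finset.sum_congr rfl h1]
    simp; ring
  exact_mod_cast h

lemma sum_sum_sub_eq (h : ℤ → ℂ) (hneg : ∀ m < 0, h m = 0) (N : ℕ) :
    ∑ j ∈ Finset.range N, ∑ k ∈ Finset.range N, h ((j : ℤ) - k) =
      ∑ n ∈ Finset.range N, ((N : ℂ) - n) * h n := by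
  induction N with
  | zero => simp
  | succ N ih =>
    have h1 : ∀ j ∈ Finset.range N, ∑ k ∈ Finset.range (N + 1), h ((j : ℤ) - k) =
        ∑ k ∈ Finset.range N, h ((j : ℤ) - k) := by
      intro j hj
      rw [Finset.sum_range_succ, hneg _ (by have := Finset.mem_range.1 hj; omega), add_zero]
    rw [Finset.sum_range_succ, Finset.sum_congr rfl h1, ih]
    have h2 : ∑ k ∈ Finset.range (N + 1), h ((N : ℤ) - k) =
        ∑ n ∈ Finset.range (N + 1), h (n : ℤ) := by
      rw [← Finset.sum_range_reflect]
      refine Finset.sum_congr rfl fun k hk => ?_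
      have := Finset.mem_range.1 hk
      congr 1
      omega
    rw [h2, Finset.sum_range_succ _ N, Finset.sum_range_succ _ N]
    push_cast
    have : ∀ n : ℕ, ((N : ℂ) + 1 - n) * h n = ((N : ℂ) - n) * h n + h n := fun n => by ring
    simp_rw [this, Finset.sum_add_distrib]
    ring

/-- Fejér means of an integrable function with spectrum in `[0, ∞)`, sampled at `n / R`. -/
noncomputable def fejerPoly (F : ℝ → ℂ) (R : ℝ) (N : ℕ) : Polynomial ℂ :=
  ∑ n ∈ Finset.range N,
    Polynomial.C (((N : ℂ) - n) * fourierInt F (n / R)) * Polynomial.X ^ n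

lemma fejerPoly_coeff (F : ℝ → ℂ) (R : ℝ) {N n : ℕ} (hn : n < N) :
    (fejerPoly F R N).coeff n = ((N : ℂ) - n) * fourierInt F (n / R) := by
  rw [fejerPoly, Polynomial.finsetSum_coeff]
  simp only [Polynomial.coeff_C_mul_X_pow]
  rw [Finset.sum_ite_eq]
  simp [hn]

lemma fejerPoly_eval {F : ℝ → ℂ} (hF : Integrable F) (hneg : ∀ ξ < 0, fourierInt F ξ = 0)
    {R : ℝ} (hR : 0 < R) (N : ℕ) (θ : ℝ) :
    (fejerPoly F R N).eval (circleMap 0 1 θ) =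
      ∫ t, F t * ((‖expSum N (θ - t / R)‖ ^ 2 : ℝ) : ℂ) := by
  have h1 : (fejerPoly F R N).eval (circleMap 0 1 θ) = ∑ n ∈ Finset.range N, ((N : ℂ) - n) *
      (fourierInt F (((n : ℤ) : ℝ) / R) * Complex.exp ((((n : ℤ) : ℝ) * θ : ℝ) * Complex.I)) := by
    rw [fejerPoly, Polynomial.eval_finsetSum]
    refine Finset.sum_congr rfl fun n _ => ?_
    simp only [Polynomial.eval_mul, Polynomial.eval_C, Polynomial.eval_pow, Polynomial.eval_X]
    rw [circleMap_zero, Complex.ofReal_one, one_mul, ← Complex.exp_nat_mul]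
    push_cast
    ring_nf
  rw [h1, ← sum_sum_sub_eq (fun m : ℤ => fourierInt F ((m : ℝ) / R) *
    Complex.exp (((m : ℝ) * θ : ℝ) * Complex.I))]
  · simp_rw [norm_expSum_sq, Finset.mul_sum]
    have e : ∀ (m : ℤ) (t : ℝ), F t * Complex.exp ((m * (θ - t / R) : ℝ) * Complex.I) =
        F t * Complex.exp (-((m / R : ℝ) * t : ℝ) * Complex.I) *
          Complex.exp (((m : ℝ) * θ : ℝ) * Complex.I) := by
      intro m t
      rw [mul_assoc, ← Complex.exp_add]
      congr 2
      push_cast; ring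
    have hint : ∀ m : ℤ, Integrable fun t =>
        F t * Complex.exp ((m * (θ - t / R) : ℝ) * Complex.I) := by
      intro m
      simp_rw [e]
      exact (integrable_mul_exp hF _).mul_const _
    rw [integral_finsetSum _ fun j _ => integrable_finsetSum _ fun k _ => hint _]
    refine Finset.sum_congr rfl fun j _ => ?_
    rw [integral_finsetSum _ fun k _ => hint _]
    refine Finset.sum_congr rfl fun k _ => ?_
    simp_rw [e]
    rw [integral_mul_const]
    rfl
  · intro m hm
    rw [hneg _ (div_neg_of_neg_of_pos (by exact_mod_cast hm) hR), zero_mul]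

lemma integral_norm_fejerPoly_le {F : ℝ → ℂ} (hF : Integrable F)
    (hneg : ∀ ξ < 0, fourierInt F ξ = 0) {R : ℝ} (hR : 0 < R) (N : ℕ) :
    ∫ θ in (0 : ℝ)..2 * π, ‖(fejerPoly F R N).eval (circleMap 0 1 θ)‖ ≤
      2 * π * N * ∫ t, ‖F t‖ := by
  have hK : Continuous fun q : ℝ × ℝ => ‖expSum N (q.1 - q.2 / R)‖ ^ 2 := by
    have := continuous_expSum N
    fun_prop
  have hprod : Integrable (Function.uncurry fun θ t => ‖F t‖ * ‖expSum N (θ - t / R)‖ ^ 2)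
      ((volume.restrict (Ioc 0 (2 * π))).prod volume) := by
    have h0 : Integrable (fun q : ℝ × ℝ => ‖F q.2‖)
      ((volume.restrict (Ioc 0 (2 * π))).prod volume) := hF.norm.comp_snd _
    refine h0.mul_bdd (c := (N : ℝ) ^ 2) hK.aestronglyMeasurable (Eventually.of_forall fun q => ?_)
    rw [norm_pow, norm_norm]
    gcongr
    exact norm_expSum_le _ _
  calc ∫ θ in (0 : ℝ)..2 * π, ‖(fejerPoly F R N).eval (circleMap 0 1 θ)‖
      ≤ ∫ θ in (0 : ℝ)..2 * π, ∫ t, ‖F t‖ * ‖expSum N (θ - t / R)‖ ^ 2 := by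
        refine intervalIntegral.integral_mono_on Real.two_pi_pos.le
          (Continuous.intervalIntegrable (by
            have := (fejerPoly F R N).continuous
            have := continuous_circleMap 0 1
            fun_prop) _ _) ?_ ?_
        · rw [intervalIntegrable_iff_integrableOn_Ioc_of_le Real.two_pi_pos.le]
          exact hprod.integral_prod_left
        · intro θ _
          rw [fejerPoly_eval hF hneg hR]
          refine (norm_integral_le_integral_norm _).trans (le_of_eq ?_)
          congr 1
          funext t
          rw [norm_mul, Complex.norm_real, norm_pow, norm_norm]
    _ = ∫ t, ∫ θ in (0 : ℝ)..2 * π, ‖F t‖ * ‖expSum N (θ - t / R)‖ ^ 2 := by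
        simp_rw [intervalIntegral.integral_of_le Real.two_pi_pos.le]
        exact integral_integral_swap hprod
    _ = 2 * π * N * ∫ t, ‖F t‖ := by
        simp_rw [intervalIntegral.integral_const_mul, integral_norm_expSum_sq]
        rw [integral_mul_const]; ring

lemma sum_norm_fourierInt_div_le {F : ℝ → ℂ} (hF : Integrable F)
    (hneg : ∀ ξ < 0, fourierInt F ξ = 0) {R : ℝ} (hR : 0 < R) (M : ℕ) :
    ∑ n ∈ Finset.range M, ‖fourierInt F (n / R)‖ / (n + 1) ≤ 16 * ∫ t, ‖F t‖ := by
  rcases Nat.eq_zero_or_pos M with rfl | hM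
  · simp; positivity
  have h1 := sum_norm_coeff_div_le (fejerPoly F R (2 * M)) M
  have h2 := integral_norm_fejerPoly_le hF hneg hR (2 * M)
  have hM' : (0 : ℝ) < M := by exact_mod_cast hM
  have h3 : (M : ℝ) * ∑ n ∈ Finset.range M, ‖fourierInt F (n / R)‖ / (n + 1) ≤
      ∑ n ∈ Finset.range M, ‖(fejerPoly F R (2 * M)).coeff n‖ / (n + 1) := by
    rw [Finset.mul_sum]
    refine Finset.sum_le_sum fun n hn => ?_
    have hn' := Finset.mem_range.1 hn
    have hn'' : (n : ℝ) ≤ M := by exact_mod_cast hn'.le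
    rw [fejerPoly_coeff F R (by omega), norm_mul]
    have : ‖(((2 * M : ℕ) : ℂ) - n)‖ = 2 * M - n := by
      have e : (((2 * M : ℕ) : ℂ) - n) = ((2 * M - n : ℝ) : ℂ) := by push_cast; ring
      rw [e, Complex.norm_real, Real.norm_of_nonneg (by linarith)]
    rw [this, ← mul_div_assoc]
    gcongr
    linarith
  have h4 : 8 * (2 * π)⁻¹ * ∫ θ in (0 : ℝ)..2 * π,
      ‖(fejerPoly F R (2 * M)).eval (circleMap 0 1 θ)‖ ≤ M * (16 * ∫ t, ‖F t‖) := by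
    calc _ ≤ 8 * (2 * π)⁻¹ * (2 * π * (2 * M : ℕ) * ∫ t, ‖F t‖) := by gcongr
      _ = _ := by push_cast; field_simp; ring
  exact le_of_mul_le_mul_left (h3.trans (h1.trans h4)) hM'

/-- **Hardy's inequality** on the line, for integrable functions with spectrum in `[0, ∞)`. -/
theorem lintegral_norm_fourierInt_div_le {F : ℝ → ℂ} (hF : Integrable F)
    (hneg : ∀ ξ < 0, fourierInt F ξ = 0) :
    ∫⁻ ξ in Ioi (0 : ℝ), ENNReal.ofReal (‖fourierInt F ξ‖ / ξ) ≤
      ENNReal.ofReal (16 * ∫ t, ‖F t‖) := by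
  have hc := continuous_fourierInt hF
  set φ : ℕ → ℝ → ENNReal := fun m ξ => ENNReal.ofReal
    (‖fourierInt F ((⌊(m + 1 : ℝ) * ξ⌋₊ : ℝ) / (m + 1))‖ /
      (((⌊(m + 1 : ℝ) * ξ⌋₊ : ℝ) + 1) / (m + 1))) with hφ
  have hmeas : ∀ m, Measurable (φ m) := by
    intro m
    have h1 : Measurable fun ξ : ℝ => ((⌊(m + 1 : ℝ) * ξ⌋₊ : ℕ) : ℝ) :=
      measurable_from_nat.comp (Nat.measurable_floor.comp (by fun_prop))
    have h2 := hc.measurable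
    exact ENNReal.measurable_ofReal.comp
      ((h2.comp (h1.div_const _)).norm.div ((h1.add_const _).div_const _))
  have hbound : ∀ m, ∫⁻ ξ in Ioi (0 : ℝ), φ m ξ ≤ ENNReal.ofReal (16 * ∫ t, ‖F t‖) := by
    intro m
    have hm : (0 : ℝ) < m + 1 := by positivity
    have hsub : Ioi (0 : ℝ) ⊆ ⋃ n : ℕ, Ico ((n : ℝ) / (m + 1)) ((n + 1) / (m + 1)) := by
      intro ξ hξ
      have hξ' : 0 ≤ (m + 1 : ℝ) * ξ := mul_nonneg hm.le (le_of_lt hξ)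
      refine mem_iUnion.2 ⟨⌊(m + 1 : ℝ) * ξ⌋₊, ?_, ?_⟩
      · rw [div_le_iff₀ hm]; linarith [Nat.floor_le hξ']
      · rw [lt_div_iff₀ hm]; linarith [Nat.lt_floor_add_one ((m + 1 : ℝ) * ξ)]
    have hpiece : ∀ n : ℕ, ∫⁻ ξ in Ico ((n : ℝ) / (m + 1)) ((n + 1) / (m + 1)), φ m ξ =
        ENNReal.ofReal (‖fourierInt F (n / (m + 1))‖ / (n + 1)) := by
      intro n
      have : ∀ ξ ∈ Ico ((n : ℝ) / (m + 1)) ((n + 1) / (m + 1)), φ m ξ =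
          ENNReal.ofReal (‖fourierInt F (n / (m + 1))‖ / ((n + 1) / (m + 1))) := by
        rintro ξ ⟨h1, h2⟩
        have : ⌊(m + 1 : ℝ) * ξ⌋₊ = n := by
          rw [div_le_iff₀ hm] at h1
          rw [lt_div_iff₀ hm] at h2
          rw [Nat.floor_eq_iff (by nlinarith [(Nat.cast_nonneg n : (0 : ℝ) ≤ n)])]
          constructor <;> linarith
        simp only [hφ, this]
      rw [setLIntegral_congr_fun measurableSet_Ico this, setLIntegral_const, Real.volume_Ico,
        ← ENNReal.ofReal_mul (by positivity)]
      congr 1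
      field_simp
      ring
    calc ∫⁻ ξ in Ioi (0 : ℝ), φ m ξ
        ≤ ∫⁻ ξ in ⋃ n : ℕ, Ico ((n : ℝ) / (m + 1)) ((n + 1) / (m + 1)), φ m ξ :=
          lintegral_mono_set hsub
      _ ≤ ∑' n : ℕ, ∫⁻ ξ in Ico ((n : ℝ) / (m + 1)) ((n + 1) / (m + 1)), φ m ξ :=
          lintegral_iUnion_le _ _
      _ = ∑' n : ℕ, ENNReal.ofReal (‖fourierInt F (n / (m + 1))‖ / (n + 1)) := by
          simp_rw [hpiece]
      _ ≤ _ := by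
          refine ENNReal.tsum_le_of_sum_range_le fun M => ?_
          rw [← ENNReal.ofReal_sum_of_nonneg fun _ _ => by positivity]
          exact ENNReal.ofReal_le_ofReal (sum_norm_fourierInt_div_le hF hneg hm M)
  have hlim : ∀ ξ ∈ Ioi (0 : ℝ), Tendsto (fun m => φ m ξ) atTop
      (nhds (ENNReal.ofReal (‖fourierInt F ξ‖ / ξ))) := by
    intro ξ hξ
    have hat : Tendsto (fun m : ℕ => (m + 1 : ℝ)) atTop atTop :=
      tendsto_atTop_add_const_right _ _ tendsto_natCast_atTop_atTop
    have h1 : Tendsto (fun m : ℕ => (⌊(m + 1 : ℝ) * ξ⌋₊ : ℝ) / (m + 1)) atTop (nhds ξ) := by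
      have := (tendsto_nat_floor_mul_div_atTop (R := ℝ) (le_of_lt hξ)).comp hat
      refine this.congr fun m => ?_
      simp [mul_comm]
    have h2 : Tendsto (fun m : ℕ => ((⌊(m + 1 : ℝ) * ξ⌋₊ : ℝ) + 1) / (m + 1)) atTop
        (nhds ξ) := by
      have := h1.add (tendsto_const_nhds (x := (1 : ℝ)).div_atTop hat)
      simp only [add_zero] at this
      exact this.congr fun m => by rw [add_div]
    refine ENNReal.tendsto_ofReal (Tendsto.div ?_ h2 (ne_of_gt hξ))
    exact ((hc.norm.tendsto ξ).comp h1)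
  calc _ = ∫⁻ ξ in Ioi (0 : ℝ), liminf (fun m => φ m ξ) atTop :=
        setLIntegral_congr_fun measurableSet_Ioi fun ξ hξ => (hlim ξ hξ).liminf_eq.symm
    _ ≤ liminf (fun m => ∫⁻ ξ in Ioi (0 : ℝ), φ m ξ) atTop := lintegral_liminf_le hmeas
    _ ≤ liminf (fun _ : ℕ => ENNReal.ofReal (16 * ∫ t, ‖F t‖)) atTop :=
        liminf_le_liminf (Eventually.of_forall hbound)
    _ = _ := liminf_const _

end Transference

section UpperHalfPlane

lemma norm_ofReal_add_I_sq (x : ℝ) : ‖(x : ℂ) + Complex.I‖ ^ 2 = 1 + x ^ 2 := by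
  rw [← Complex.normSq_eq_norm_sq, Complex.normSq_apply]
  simp; ring

lemma norm_le_norm_add_I {z : ℂ} (hz : 0 ≤ z.im) : ‖z‖ ≤ ‖z + Complex.I‖ := by
  rw [← sq_le_sq₀ (norm_nonneg _) (norm_nonneg _), ← Complex.normSq_eq_norm_sq,
    ← Complex.normSq_eq_norm_sq, Complex.normSq_apply, Complex.normSq_apply]
  simp; nlinarith

lemma one_le_norm_add_I {z : ℂ} (hz : 0 ≤ z.im) : 1 ≤ ‖z + Complex.I‖ := by
  have h := Complex.abs_im_le_norm (z + Complex.I)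
  have h2 := le_abs_self (z + Complex.I).im
  simp only [Complex.add_im, Complex.I_im] at h h2
  linarith

lemma integrable_of_decay {H : ℂ → ℂ} (hd : ∀ z : ℂ, 0 ≤ z.im → DifferentiableAt ℂ H z) {M : ℝ}
    (hM : ∀ z : ℂ, 0 ≤ z.im → ‖H z‖ ≤ M / ‖z + Complex.I‖ ^ 2) :
    Integrable fun x : ℝ => H x := by
  have hc : Continuous fun x : ℝ => H x := continuous_iff_continuousAt.2 fun x =>
    ContinuousAt.comp (f := fun x : ℝ => (x : ℂ)) (hd x (by simp)).continuousAt (by fun_prop)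
  refine (integrable_inv_one_add_sq.const_mul M).mono' hc.aestronglyMeasurable
    (Eventually.of_forall fun x => ?_)
  have := hM x (by simp)
  rwa [norm_ofReal_add_I_sq, div_eq_mul_inv] at this

/-- Cauchy's theorem on the closed upper half-plane for functions decaying quadratically. -/
lemma integral_eq_zero_of_decay {H : ℂ → ℂ} (hd : ∀ z : ℂ, 0 ≤ z.im → DifferentiableAt ℂ H z)
    {M : ℝ} (hM : ∀ z : ℂ, 0 ≤ z.im → ‖H z‖ ≤ M / ‖z + Complex.I‖ ^ 2) :
    ∫ x : ℝ, H x = 0 := by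
  have hM0 : 0 ≤ M := by
    have h1 := (norm_nonneg _).trans (hM 0 (by simp))
    simpa using h1
  have hlim := intervalIntegral_tendsto_integral (integrable_of_decay hd hM)
    tendsto_neg_atTop_atBot tendsto_id
  refine tendsto_nhds_unique hlim ?_
  have hb : Tendsto (fun R : ℝ => 4 * M / R) atTop (nhds 0) := tendsto_const_nhds.div_atTop tendsto_id
  refine squeeze_zero_norm' ?_ hb
  filter_upwards [eventually_gt_atTop 0] with R hR
  have hfar : ∀ z : ℂ, 0 ≤ z.im → R ≤ ‖z‖ → ‖H z‖ ≤ M / R ^ 2 := by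
    intro z hz hRz
    refine (hM z hz).trans ?_
    have := hRz.trans (norm_le_norm_add_I hz)
    gcongr
  have hrect := Complex.integral_boundary_rect_eq_zero_of_differentiableOn H (-R : ℝ)
    (R + R * Complex.I) (by
      intro z hz
      have hz2 := hz.2
      simp only [Complex.ofReal_im, Complex.add_im, Complex.mul_im, Complex.ofReal_re,
        Complex.I_im, Complex.I_re, mem_preimage] at hz2
      rw [uIcc_of_le (by linarith)] at hz2
      exact (hd z hz2.1).differentiableWithinAt)
  simp only [Complex.ofReal_re, Complex.ofReal_im, Complex.add_re, Complex.add_im, Complex.mul_re,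
    Complex.mul_im, Complex.I_re, Complex.I_im, mul_zero, mul_one, zero_mul, sub_zero, add_zero,
    zero_add, Complex.ofReal_zero, smul_eq_mul] at hrect
  have htop : ‖∫ x : ℝ in -R..R, H (x + R * Complex.I)‖ ≤ M / R ^ 2 * |R - -R| := by
    refine intervalIntegral.norm_integral_le_of_norm_le_const fun x _ => hfar _ (by simp [hR.le]) ?_
    have := Complex.abs_im_le_norm ((x : ℂ) + R * Complex.I)
    simpa [abs_of_pos hR] using this
  have hside : ∀ c : ℝ, |c| = R →
      ‖∫ y : ℝ in (0 : ℝ)..R, H (c + y * Complex.I)‖ ≤ M / R ^ 2 * |R - 0| := by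
    intro c hc
    refine intervalIntegral.norm_integral_le_of_norm_le_const fun y hy => hfar _ ?_ ?_
    · rw [uIoc_of_le hR.le] at hy
      simpa using hy.1.le
    · have := Complex.abs_re_le_norm ((c : ℂ) + y * Complex.I)
      simpa [hc] using this
  have h1 := hside R (abs_of_pos hR)
  have h2 := hside (-R) (by rw [abs_neg, abs_of_pos hR])
  have e : ∫ x : ℝ in -R..id R, H x = (∫ x : ℝ in -R..R, H (x + R * Complex.I)) -
      Complex.I * (∫ y : ℝ in (0 : ℝ)..R, H (R + y * Complex.I)) +
      Complex.I * (∫ y : ℝ in (0 : ℝ)..R, H ((-R : ℝ) + y * Complex.I)) := by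
    simp only [id]
    linear_combination hrect
  rw [e]
  refine (norm_add_le _ _).trans ((add_le_add_left (norm_sub_le _ _) _).trans ?_)
  rw [norm_mul, norm_mul, Complex.norm_I, one_mul, one_mul]
  have e2 : |R - -R| = 2 * R := by rw [abs_of_pos (by linarith)]; ring
  have e3 : |R - 0| = R := by rw [sub_zero, abs_of_pos hR]
  rw [e2] at htop
  rw [e3] at h1 h2
  have e4 : 4 * M / R = M / R ^ 2 * (2 * R) + M / R ^ 2 * R + M / R ^ 2 * R := by
    field_simp; ring
  rw [e4]
  gcongr

/-- Poisson's formula at the point `i`. -/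
lemma integral_div_one_add_sq {b : ℂ → ℂ} {c : ℝ} (hc : 0 < c)
    (hd : ∀ z : ℂ, -c < z.im → DifferentiableAt ℂ b z) (hb : ∀ z : ℂ, 0 ≤ z.im → ‖b z‖ ≤ 1) :
    ∫ x : ℝ, (b x - b Complex.I) * ((1 + x ^ 2 : ℝ) : ℂ)⁻¹ = 0 := by
  set S : Set ℂ := {z | -c < z.im} with hS
  have hSo : IsOpen S := isOpen_lt continuous_const Complex.continuous_im
  have hIS : Complex.I ∈ S := by simp [hS]; linarith
  have hds : DifferentiableOn ℂ (dslope b Complex.I) S :=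
    (Complex.differentiableOn_dslope (hSo.mem_nhds hIS)).2
      fun z hz => (hd z hz).differentiableWithinAt
  have hball : Metric.closedBall Complex.I (1 / 2) ⊆ S := by
    intro z hz
    have h1 : ‖z - Complex.I‖ ≤ 1 / 2 := by simpa [dist_eq_norm] using hz
    have h2 := (abs_le.1 ((Complex.abs_im_le_norm (z - Complex.I)).trans h1)).1
    simp only [Complex.sub_im, Complex.I_im] at h2
    simp only [hS, mem_ofPred_eq]; linarith
  obtain ⟨M, hM⟩ := (isCompact_closedBall Complex.I (1 / 2)).exists_bound_of_continuousOn
    (hds.continuousOn.mono hball)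
  have hne : ∀ z : ℂ, 0 ≤ z.im → z + Complex.I ≠ 0 := fun z hz h => by
    have := one_le_norm_add_I hz
    rw [h, norm_zero] at this; linarith
  have key := integral_eq_zero_of_decay (H := fun z => dslope b Complex.I z / (z + Complex.I))
    (M := max (3 * M) 10) ?_ ?_
  · rw [← key]
    congr 1
    funext x
    have hx : (x : ℂ) ≠ Complex.I := fun h => by
      have := congrArg Complex.im h; simp at this
    have hx' : (x : ℂ) - Complex.I ≠ 0 := sub_ne_zero.2 hx
    have hx2 : (x : ℂ) + Complex.I ≠ 0 := hne x (by simp)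
    have e : ((1 + x ^ 2 : ℝ) : ℂ) = (x - Complex.I) * (x + Complex.I) := by
      push_cast
      linear_combination Complex.I_sq
    rw [dslope_of_ne _ hx, slope_def_field, e]
    field_simp
  · intro z hz
    have h1 : DifferentiableAt ℂ (dslope b Complex.I) z :=
      hds.differentiableAt (hSo.mem_nhds (by simp only [hS, mem_ofPred_eq]; linarith))
    exact h1.div (by fun_prop) (hne z hz)
  · intro z hz
    have h1 := one_le_norm_add_I hz
    rw [norm_div, sq, ← div_div]
    gcongr
    rw [le_div_iff₀ (by linarith)]
    by_cases h : ‖z - Complex.I‖ ≤ 1 / 2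
    · have h2 := hM z (by simpa [dist_eq_norm] using h)
      have h3 : ‖z + Complex.I‖ ≤ 3 := by
        calc ‖z + Complex.I‖ = ‖(z - Complex.I) + 2 * Complex.I‖ := by ring_nf
          _ ≤ ‖z - Complex.I‖ + ‖2 * Complex.I‖ := norm_add_le _ _
          _ ≤ 3 := by simp; linarith
      refine le_trans ?_ (le_max_left _ _)
      nlinarith [norm_nonneg (dslope b Complex.I z)]
    · push Not at h
      have hzI : z ≠ Complex.I := fun h' => by rw [h'] at h; norm_num at h
      have h3 : ‖z + Complex.I‖ ≤ 5 * ‖z - Complex.I‖ := by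
        calc ‖z + Complex.I‖ = ‖(z - Complex.I) + 2 * Complex.I‖ := by ring_nf
          _ ≤ ‖z - Complex.I‖ + ‖2 * Complex.I‖ := norm_add_le _ _
          _ ≤ _ := by simp; linarith
      refine le_trans ?_ (le_max_right _ _)
      rw [dslope_of_ne _ hzI, slope_def_field, norm_div, div_mul_eq_mul_div,
        div_le_iff₀ (by linarith)]
      have h4 : ‖b z - b Complex.I‖ ≤ 2 := by
        have := norm_sub_le (b z) (b Complex.I)
        have := hb z hz
        have := hb Complex.I (by simp)
        linarith
      nlinarith [norm_nonneg (b z - b Complex.I)]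

lemma integrable_bdd_mul_inv_one_add_sq {h : ℝ → ℝ} (hm : Continuous h) {B : ℝ}
    (hb : ∀ x, ‖h x‖ ≤ B) : Integrable fun x => h x * (1 + x ^ 2)⁻¹ :=
  integrable_inv_one_add_sq.bdd_mul hm.aestronglyMeasurable (Eventually.of_forall hb)

/-- A bounded analytic function which is close to `1` at `i` is close to `1` on the line. -/
lemma integral_norm_one_sub_sq_le {b : ℂ → ℂ} {c : ℝ} (hc : 0 < c)
    (hd : ∀ z : ℂ, -c < z.im → DifferentiableAt ℂ b z) (hb : ∀ z : ℂ, 0 ≤ z.im → ‖b z‖ ≤ 1) :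
    ∫ x : ℝ, ‖1 - b x‖ ^ 2 * (1 + x ^ 2)⁻¹ ≤ 2 * π * ‖1 - b Complex.I‖ := by
  have hcont : Continuous fun x : ℝ => b x := continuous_iff_continuousAt.2 fun x =>
    ContinuousAt.comp (f := fun x : ℝ => (x : ℂ)) (hd x (by simpa using hc)).continuousAt
      (by fun_prop)
  have hbx : ∀ x : ℝ, ‖b x‖ ≤ 1 := fun x => hb x (by simp)
  have hi1 : Integrable fun x : ℝ => ‖1 - b x‖ ^ 2 * (1 + x ^ 2)⁻¹ := by
    refine integrable_bdd_mul_inv_one_add_sq (B := 4) ((continuous_const.sub hcont).norm.pow 2) fun x => ?_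
    rw [norm_pow, norm_norm]
    have := norm_sub_le 1 (b x)
    rw [norm_one] at this
    nlinarith [norm_nonneg (1 - b x), hbx x]
  have hi2 : Integrable fun x : ℝ => 2 * (1 - (b x).re) * (1 + x ^ 2)⁻¹ := by
    refine integrable_bdd_mul_inv_one_add_sq (B := 4)
      (continuous_const.mul (continuous_const.sub (Complex.continuous_re.comp hcont))) fun x => ?_
    have := abs_le.1 ((Complex.abs_re_le_norm (b x)).trans (hbx x))
    rw [Real.norm_eq_abs, abs_le]
    constructor <;> linarith [this.1, this.2]
  have hi3 : Integrable fun x : ℝ => ((b x).re - (b Complex.I).re) * (1 + x ^ 2)⁻¹ := by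
    refine integrable_bdd_mul_inv_one_add_sq (B := 2)
      ((Complex.continuous_re.comp hcont).sub continuous_const) fun x => ?_
    have := abs_le.1 ((Complex.abs_re_le_norm (b x)).trans (hbx x))
    have h' := abs_le.1 ((Complex.abs_re_le_norm (b Complex.I)).trans (hb _ (by simp)))
    rw [Real.norm_eq_abs, abs_le]
    constructor <;> linarith [this.1, this.2, h'.1, h'.2]
  have hre : ∫ x : ℝ, ((b x).re - (b Complex.I).re) * (1 + x ^ 2)⁻¹ = 0 := by
    have h0 := integral_div_one_add_sq hc hd hb
    have hint : Integrable fun x : ℝ => (b x - b Complex.I) * ((1 + x ^ 2 : ℝ) : ℂ)⁻¹ := by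
      have h1 : Integrable fun x : ℝ => ((1 + x ^ 2 : ℝ) : ℂ)⁻¹ := by
        have := integrable_inv_one_add_sq.ofReal (𝕜 := ℂ)
        refine this.congr (Eventually.of_forall fun x => ?_)
        simp
      refine h1.bdd_mul (c := 2) (hcont.sub continuous_const).aestronglyMeasurable
        (Eventually.of_forall fun x => ?_)
      have := norm_sub_le (b x) (b Complex.I)
      have := hbx x
      have := hb Complex.I (by simp)
      linarith
    have h2 := integral_re hint
    rw [h0] at h2
    simp only [map_zero] at h2
    rw [← h2]
    congr 1
    funext x
    rw [← Complex.ofReal_inv]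
    simp [-Complex.ofReal_inv, -Complex.ofReal_add]
  calc ∫ x : ℝ, ‖1 - b x‖ ^ 2 * (1 + x ^ 2)⁻¹
      ≤ ∫ x : ℝ, 2 * (1 - (b x).re) * (1 + x ^ 2)⁻¹ := by
        refine integral_mono hi1 hi2 fun x => ?_
        have h1 : ‖1 - b x‖ ^ 2 = 1 - 2 * (b x).re + ‖b x‖ ^ 2 := by
          rw [← Complex.normSq_eq_norm_sq, ← Complex.normSq_eq_norm_sq, Complex.normSq_apply,
            Complex.normSq_apply]
          simp; ring
        have h2 : ‖b x‖ ^ 2 ≤ 1 := pow_le_one₀ (norm_nonneg _) (hbx x)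
        have h3 : (0 : ℝ) ≤ (1 + x ^ 2)⁻¹ := by positivity
        simp only
        gcongr
        linarith
    _ = ∫ x : ℝ, (2 * (1 - (b Complex.I).re) * (1 + x ^ 2)⁻¹ -
          2 * (((b x).re - (b Complex.I).re) * (1 + x ^ 2)⁻¹)) := by
        congr 1; funext x; ring
    _ = 2 * (1 - (b Complex.I).re) * π := by
        rw [integral_sub (integrable_inv_one_add_sq.const_mul _) (hi3.const_mul _),
          integral_const_mul, integral_const_mul, hre, integral_univ_inv_one_add_sq]
        ring
    _ ≤ _ := by
        have h1 := Complex.re_le_norm (1 - b Complex.I)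
        simp only [Complex.sub_re, Complex.one_re] at h1
        nlinarith [Real.pi_pos]

/-- Equi-integrability: `∫ ‖F‖ ‖β‖` is small once `β` is bounded and small in weighted `L²`. -/
lemma exists_integral_norm_mul_le {F : ℝ → ℂ} (hF : Integrable F) {τ : ℝ} (hτ : 0 < τ) :
    ∃ σ > 0, ∀ β : ℝ → ℂ, Continuous β → (∀ x, ‖β x‖ ≤ 2) →
      ∫ x, ‖β x‖ ^ 2 * (1 + x ^ 2)⁻¹ ≤ σ → ∫ x, ‖F x‖ * ‖β x‖ ≤ τ := by
  have hw : Integrable fun x : ℝ => (1 + x ^ 2)⁻¹ := integrable_inv_one_add_sq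
  have hpos : ∀ n : ℝ, Integrable fun x : ℝ => max (‖F x‖ - n * (1 + x ^ 2)⁻¹) 0 := fun n =>
    (hF.norm.sub (hw.const_mul n)).pos_part
  have hlim : Tendsto (fun n : ℕ => ∫ x : ℝ, max (‖F x‖ - n * (1 + x ^ 2)⁻¹) 0) atTop
      (nhds 0) := by
    have := tendsto_integral_of_dominated_convergence (μ := volume)
      (F := fun (n : ℕ) (x : ℝ) => max (‖F x‖ - n * (1 + x ^ 2)⁻¹) 0) (f := fun _ => (0 : ℝ))
      (fun x => ‖F x‖) (fun n => (hpos n).aestronglyMeasurable) hF.norm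
      (fun n => Eventually.of_forall fun x => ?_) (Eventually.of_forall fun x => ?_)
    · simpa using this
    · have : 0 ≤ (n : ℝ) * (1 + x ^ 2)⁻¹ := by positivity
      rw [Real.norm_of_nonneg (le_max_right _ _)]
      exact max_le (by linarith) (norm_nonneg _)
    · refine tendsto_const_nhds.congr' ?_
      obtain ⟨m, hm⟩ := exists_nat_ge (‖F x‖ * (1 + x ^ 2))
      filter_upwards [eventually_ge_atTop m] with n hn
      have hmn : (m : ℝ) ≤ n := by exact_mod_cast hn
      rw [eq_comm, max_eq_right]
      rw [sub_nonpos, ← div_eq_mul_inv, le_div_iff₀ (by positivity)]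
      linarith
  obtain ⟨m, hm⟩ := ((hlim.eventually (gt_mem_nhds (show (0 : ℝ) < τ / 4 by positivity))).and
    (eventually_ge_atTop 1)).exists
  have hm0 : (0 : ℝ) < m := by exact_mod_cast hm.2
  have hπ := Real.pi_pos
  set κ : ℝ := τ / (4 * π * m) with hκ
  have hκ0 : 0 < κ := by positivity
  refine ⟨κ * τ / (4 * m), by positivity, fun β hβc hβ hσ => ?_⟩
  have hi2 : Integrable fun x : ℝ => ‖β x‖ ^ 2 * (1 + x ^ 2)⁻¹ := by
    refine integrable_bdd_mul_inv_one_add_sq (B := 4) (by fun_prop) fun x => ?_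
    rw [norm_pow, norm_norm]
    nlinarith [norm_nonneg (β x), hβ x]
  have hi1 : Integrable fun x => ‖F x‖ * ‖β x‖ :=
    hF.norm.mul_bdd (c := 2) (by fun_prop) (Eventually.of_forall fun x => by simpa using hβ x)
  have hi3 : Integrable fun x : ℝ =>
      m * κ * (1 + x ^ 2)⁻¹ + m / κ * (‖β x‖ ^ 2 * (1 + x ^ 2)⁻¹) :=
    (hw.const_mul _).add (hi2.const_mul _)
  calc ∫ x, ‖F x‖ * ‖β x‖ ≤ ∫ x, (2 * max (‖F x‖ - m * (1 + x ^ 2)⁻¹) 0 +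
        (m * κ * (1 + x ^ 2)⁻¹ + m / κ * (‖β x‖ ^ 2 * (1 + x ^ 2)⁻¹))) := by
        refine integral_mono hi1 (((hpos m).const_mul 2).add
          hi3) fun x => ?_
        simp only
        set w : ℝ := (1 + x ^ 2)⁻¹
        have hw0 : 0 < w := by positivity
        set s := ‖β x‖
        have hs0 : 0 ≤ s := norm_nonneg _
        have h1 : ‖F x‖ ≤ max (‖F x‖ - m * w) 0 + m * w := by
          linarith [le_max_left (‖F x‖ - m * w) 0]
        have h2 : s ≤ κ + s ^ 2 / κ := by
          rw [← sub_nonneg]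
          have : κ + s ^ 2 / κ - s = ((κ - s / 2) ^ 2 + 3 / 4 * s ^ 2) / κ := by field_simp; ring
          rw [this]; positivity
        calc ‖F x‖ * s ≤ (max (‖F x‖ - m * w) 0 + m * w) * s := by gcongr
          _ = max (‖F x‖ - m * w) 0 * s + m * w * s := by ring
          _ ≤ max (‖F x‖ - m * w) 0 * 2 + m * w * (κ + s ^ 2 / κ) := by
              gcongr
              exact hβ x
          _ = _ := by ring
    _ = 2 * (∫ x, max (‖F x‖ - m * (1 + x ^ 2)⁻¹) 0) +
        (m * κ * π + m / κ * ∫ x, ‖β x‖ ^ 2 * (1 + x ^ 2)⁻¹) := by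
        rw [integral_add ((hpos m).const_mul 2) hi3,
          integral_add (hw.const_mul _) (hi2.const_mul _), integral_const_mul, integral_const_mul,
          integral_const_mul, integral_univ_inv_one_add_sq]
    _ ≤ 2 * (τ / 4) + (m * κ * π + m / κ * (κ * τ / (4 * m))) := by
        have := hm.1.le
        gcongr
    _ = τ := by
        rw [hκ]; field_simp; ring

end UpperHalfPlane

section CauchyIntegral

/-- The Cauchy integral of a function on the line, normalised to have nonnegative real part on
the upper half-plane when the function is nonnegative. -/
noncomputable def cauchyInt (g : ℝ → ℂ) (z : ℂ) : ℂ := ∫ t, g t * (Complex.I / (z - t))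

lemma im_le_norm_sub_ofReal (z : ℂ) (t : ℝ) : z.im ≤ ‖z - t‖ := by
  have h := (le_abs_self _).trans (Complex.abs_im_le_norm (z - t))
  simpa using h

lemma sub_ofReal_ne_zero {z : ℂ} (hz : 0 < z.im) (t : ℝ) : z - t ≠ 0 :=
  norm_pos_iff.1 (hz.trans_le (im_le_norm_sub_ofReal z t))

lemma norm_I_div_le {z : ℂ} (hz : 0 < z.im) (t : ℝ) : ‖Complex.I / (z - t)‖ ≤ 1 / z.im := by
  rw [norm_div, Complex.norm_I]
  exact one_div_le_one_div_of_le hz (im_le_norm_sub_ofReal z t)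

lemma continuous_I_div {z : ℂ} (hz : 0 < z.im) : Continuous fun t : ℝ => Complex.I / (z - t) :=
  continuous_const.div (by fun_prop) (sub_ofReal_ne_zero hz)

lemma integrable_cauchy {g : ℝ → ℂ} (hg : Integrable g) {z : ℂ} (hz : 0 < z.im) :
    Integrable fun t : ℝ => g t * (Complex.I / (z - t)) :=
  hg.mul_bdd (continuous_I_div hz).aestronglyMeasurable
    (Eventually.of_forall fun t => norm_I_div_le hz t)

lemma norm_cauchyInt_le {g : ℝ → ℂ} (hg : Integrable g) {z : ℂ} (hz : 0 < z.im) :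
    ‖cauchyInt g z‖ ≤ (∫ t, ‖g t‖) / z.im := by
  rw [cauchyInt, div_eq_mul_one_div, ← integral_mul_const]
  refine norm_integral_le_of_norm_le (hg.norm.mul_const _) (Eventually.of_forall fun t => ?_)
  rw [norm_mul]
  gcongr
  exact norm_I_div_le hz t

lemma differentiableAt_cauchyInt {g : ℝ → ℂ} (hg : Integrable g) {z : ℂ} (hz : 0 < z.im) :
    DifferentiableAt ℂ (cauchyInt g) z := by
  have him : ∀ w ∈ Metric.ball z (z.im / 2), z.im / 2 < w.im := by
    intro w hw
    have h1 : ‖w - z‖ < z.im / 2 := by simpa [dist_eq_norm] using hw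
    have h2 := (abs_lt.1 ((Complex.abs_im_le_norm (w - z)).trans_lt h1)).1
    simp only [Complex.sub_im] at h2
    linarith
  have hpos : ∀ w ∈ Metric.ball z (z.im / 2), 0 < w.im := fun w hw => by linarith [him w hw]
  have hs : Metric.ball z (z.im / 2) ∈ nhds z := Metric.ball_mem_nhds _ (by linarith)
  refine (hasDerivAt_integral_of_dominated_loc_of_deriv_le (μ := volume)
    (F := fun (w : ℂ) (t : ℝ) => g t * (Complex.I / (w - t)))
    (F' := fun (w : ℂ) (t : ℝ) => g t * (-Complex.I / (w - t) ^ 2))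
    (bound := fun t => ‖g t‖ * (1 / (z.im / 2) ^ 2)) hs ?_ (integrable_cauchy hg hz) ?_ ?_
    (hg.norm.mul_const _) ?_).2.differentiableAt
  · filter_upwards [hs] with w hw using (integrable_cauchy hg (hpos w hw)).aestronglyMeasurable
  · refine hg.aestronglyMeasurable.mul (Continuous.aestronglyMeasurable ?_)
    exact continuous_const.div (by fun_prop) fun t => pow_ne_zero 2 (sub_ofReal_ne_zero hz t)
  · refine Eventually.of_forall fun t w hw => ?_
    rw [norm_mul, norm_div, norm_neg, Complex.norm_I, norm_pow]
    have h1 := him w hw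
    have h2 := im_le_norm_sub_ofReal w t
    have h3 : z.im / 2 ≤ ‖w - t‖ := h1.le.trans h2
    gcongr
  · refine Eventually.of_forall fun t w hw => ?_
    have h1 := ((hasDerivAt_const w Complex.I).div ((hasDerivAt_id w).sub_const (t : ℂ))
      (sub_ofReal_ne_zero (hpos w hw) t)).const_mul (g t)
    have e : -Complex.I / (w - t) ^ 2 = (0 * (id w - t) - Complex.I * 1) / (id w - t) ^ 2 := by
      simp
    rw [e]
    exact h1

lemma cauchyInt_re_nonneg {g : ℝ → ℝ} (hg : Integrable g) (h0 : ∀ t, 0 ≤ g t) {z : ℂ}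
    (hz : 0 < z.im) : 0 ≤ (cauchyInt (fun t => (g t : ℂ)) z).re := by
  have h := integral_re (integrable_cauchy hg.ofReal hz)
  have h2 : (cauchyInt (fun t => (g t : ℂ)) z).re =
      ∫ t, RCLike.re ((g t : ℂ) * (Complex.I / (z - t))) := h.symm
  rw [h2]
  refine integral_nonneg fun t => ?_
  simp only [RCLike.re_eq_complex_re, Complex.re_ofReal_mul]
  refine mul_nonneg (h0 t) ?_
  rw [Complex.div_re]
  simp only [Complex.I_re, Complex.I_im, Complex.sub_im, Complex.ofReal_im]
  have := Complex.normSq_nonneg (z - t)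
  simp only [zero_mul, zero_div, one_mul, sub_zero, zero_add]
  positivity

lemma one_le_norm_one_add {w : ℂ} (hw : 0 ≤ w.re) : 1 ≤ ‖1 + w‖ := by
  have h := (le_abs_self _).trans (Complex.abs_re_le_norm (1 + w))
  simp only [Complex.add_re, Complex.one_re] at h
  linarith

lemma norm_le_norm_one_add {w : ℂ} (hw : 0 ≤ w.re) : ‖w‖ ≤ ‖1 + w‖ := by
  rw [← sq_le_sq₀ (norm_nonneg _) (norm_nonneg _), ← Complex.normSq_eq_norm_sq,
    ← Complex.normSq_eq_norm_sq, Complex.normSq_apply, Complex.normSq_apply]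
  simp; nlinarith

/-- For nonnegative integrable `g`, there are contractive analytic multipliers close to `1` at
height `≥ 1` which make the Cauchy integral of `g` bounded. -/
lemma exists_multiplier_of_nonneg {g : ℝ → ℝ} (hg : Integrable g) (h0 : ∀ t, 0 ≤ g t) {ε : ℝ}
    (hε : 0 < ε) : ∃ b : ℂ → ℂ, (∀ z : ℂ, 0 < z.im → DifferentiableAt ℂ b z) ∧
      (∀ z : ℂ, 0 < z.im → ‖b z‖ ≤ 1) ∧
      (∀ z : ℂ, 0 < z.im → ‖cauchyInt (fun t => (g t : ℂ)) z * b z‖ ≤ 1 / ε) ∧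
      (∀ z : ℂ, 1 ≤ z.im → ‖1 - b z‖ ≤ ε * ∫ t, ‖g t‖) := by
  set V := cauchyInt (fun t => (g t : ℂ)) with hV
  have hre : ∀ z : ℂ, 0 < z.im → 0 ≤ (ε * V z).re := fun z hz => by
    rw [Complex.re_ofReal_mul]
    exact mul_nonneg hε.le (cauchyInt_re_nonneg hg h0 hz)
  have h1 : ∀ z : ℂ, 0 < z.im → 1 ≤ ‖1 + ε * V z‖ := fun z hz => one_le_norm_one_add (hre z hz)
  have hne : ∀ z : ℂ, 0 < z.im → 1 + ε * V z ≠ 0 := fun z hz =>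
    norm_pos_iff.1 (one_pos.trans_le (h1 z hz))
  have hle : ∀ z : ℂ, 0 < z.im → ε * ‖V z‖ ≤ ‖1 + ε * V z‖ := fun z hz => by
    have := norm_le_norm_one_add (hre z hz)
    rwa [norm_mul, Complex.norm_of_nonneg hε.le] at this
  refine ⟨fun z => (1 + ε * V z)⁻¹, fun z hz => ?_, fun z hz => ?_, fun z hz => ?_,
    fun z hz => ?_⟩
  · exact (((differentiableAt_cauchyInt hg.ofReal hz).const_mul _).const_add _).inv (hne z hz)
  · rw [norm_inv]
    exact inv_le_one_of_one_le₀ (h1 z hz)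
  · rw [norm_mul, norm_inv, ← div_eq_mul_inv, div_le_div_iff₀ (by linarith [h1 z hz]) hε]
    linarith [hle z hz]
  · have hz0 : 0 < z.im := by linarith
    have e : 1 - (1 + ε * V z)⁻¹ = ε * V z / (1 + ε * V z) := by
      field_simp [hne z hz0]; ring
    rw [e, norm_div, norm_mul, Complex.norm_of_nonneg hε.le]
    have h2 : ‖V z‖ ≤ ∫ t, ‖g t‖ := by
      have h3 := norm_cauchyInt_le (hg.ofReal (𝕜 := ℂ)) hz0
      have h4 : (∫ t, ‖((g t : ℝ) : ℂ)‖) / z.im ≤ ∫ t, ‖((g t : ℝ) : ℂ)‖ :=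
        div_le_self (integral_nonneg fun _ => norm_nonneg _) hz
      simpa using h3.trans h4
    calc ε * ‖V z‖ / ‖1 + ε * V z‖ ≤ ε * ‖V z‖ := div_le_self (by positivity) (h1 z hz0)
      _ ≤ _ := by gcongr

lemma norm_one_sub_mul_le {a b : ℂ} (ha : ‖a‖ ≤ 1) : ‖1 - a * b‖ ≤ ‖1 - a‖ + ‖1 - b‖ := by
  calc ‖1 - a * b‖ = ‖(1 - a) + a * (1 - b)‖ := by ring_nf
    _ ≤ ‖1 - a‖ + ‖a‖ * ‖1 - b‖ := by rw [← norm_mul]; exact norm_add_le _ _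
    _ ≤ ‖1 - a‖ + 1 * ‖1 - b‖ := by gcongr
    _ = _ := by ring

lemma exists_multiplier {g : ℝ → ℂ} (hg : Integrable g) : ∃ A : ℝ, 0 ≤ A ∧ ∀ ε : ℝ, 0 < ε →
    ∃ b : ℂ → ℂ, (∀ z : ℂ, 0 < z.im → DifferentiableAt ℂ b z) ∧
      (∀ z : ℂ, 0 < z.im → ‖b z‖ ≤ 1) ∧
      (∀ z : ℂ, 0 < z.im → ‖cauchyInt g z * b z‖ ≤ 4 / ε) ∧
      (∀ z : ℂ, 1 ≤ z.im → ‖1 - b z‖ ≤ ε * A) := by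
  have hr : Integrable fun t => (g t).re := hg.re
  have hi : Integrable fun t => (g t).im := hg.im
  have h1 : Integrable fun t => max (g t).re 0 := hr.pos_part
  have h2 : Integrable fun t => max (-(g t).re) 0 := hr.neg_part
  have h3 : Integrable fun t => max (g t).im 0 := hi.pos_part
  have h4 : Integrable fun t => max (-(g t).im) 0 := hi.neg_part
  refine ⟨(∫ t, ‖max (g t).re 0‖) + ((∫ t, ‖max (-(g t).re) 0‖) + ((∫ t, ‖max (g t).im 0‖) +
    ∫ t, ‖max (-(g t).im) 0‖)), by positivity, fun ε hε => ?_⟩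
  obtain ⟨b₁, d₁, n₁, u₁, c₁⟩ := exists_multiplier_of_nonneg h1 (fun t => le_max_right _ _) hε
  obtain ⟨b₂, d₂, n₂, u₂, c₂⟩ := exists_multiplier_of_nonneg h2 (fun t => le_max_right _ _) hε
  obtain ⟨b₃, d₃, n₃, u₃, c₃⟩ := exists_multiplier_of_nonneg h3 (fun t => le_max_right _ _) hε
  obtain ⟨b₄, d₄, n₄, u₄, c₄⟩ := exists_multiplier_of_nonneg h4 (fun t => le_max_right _ _) hε
  have hm : ∀ a b : ℂ, ‖a‖ ≤ 1 → ‖b‖ ≤ 1 → ‖a * b‖ ≤ 1 := fun a b ha hb => by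
    rw [norm_mul]; exact mul_le_one₀ ha (norm_nonneg _) hb
  have hm' : ∀ a b : ℂ, ‖a‖ ≤ 1 / ε → ‖b‖ ≤ 1 → ‖a * b‖ ≤ 1 / ε := fun a b ha hb => by
    rw [norm_mul]
    calc ‖a‖ * ‖b‖ ≤ 1 / ε * 1 := by gcongr
      _ = _ := by ring
  refine ⟨fun z => b₁ z * (b₂ z * (b₃ z * b₄ z)), fun z hz => ?_, fun z hz => ?_, fun z hz => ?_,
    fun z hz => ?_⟩
  · exact (d₁ z hz).mul ((d₂ z hz).mul ((d₃ z hz).mul (d₄ z hz)))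
  · exact hm _ _ (n₁ z hz) (hm _ _ (n₂ z hz) (hm _ _ (n₃ z hz) (n₄ z hz)))
  · set V₁ := cauchyInt (fun t => ((max (g t).re 0 : ℝ) : ℂ)) z with hV₁
    set V₂ := cauchyInt (fun t => ((max (-(g t).re) 0 : ℝ) : ℂ)) z with hV₂
    set V₃ := cauchyInt (fun t => ((max (g t).im 0 : ℝ) : ℂ)) z with hV₃
    set V₄ := cauchyInt (fun t => ((max (-(g t).im) 0 : ℝ) : ℂ)) z with hV₄
    have i1 := integrable_cauchy (h1.ofReal (𝕜 := ℂ)) hz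
    have i2 := integrable_cauchy (h2.ofReal (𝕜 := ℂ)) hz
    have i3 := integrable_cauchy (h3.ofReal (𝕜 := ℂ)) hz
    have i4 := integrable_cauchy (h4.ofReal (𝕜 := ℂ)) hz
    have eU : cauchyInt g z = (V₁ - V₂) + Complex.I * (V₃ - V₄) := by
      simp only [hV₁, hV₂, hV₃, hV₄, cauchyInt]
      erw [← integral_sub i1 i2, ← integral_sub i3 i4, ← integral_const_mul,
        ← integral_add (i1.sub i2) ((i3.sub i4).const_mul _)]
      congr 1
      funext t
      have er : max (g t).re 0 - max (-(g t).re) 0 = (g t).re := max_zero_sub_eq_self _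
      have ei : max (g t).im 0 - max (-(g t).im) 0 = (g t).im := max_zero_sub_eq_self _
      have er' : ((max (g t).re 0 : ℝ) : ℂ) - ((max (-(g t).re) 0 : ℝ) : ℂ) = (g t).re := by
        rw [← Complex.ofReal_sub, er]
      have ei' : ((max (g t).im 0 : ℝ) : ℂ) - ((max (-(g t).im) 0 : ℝ) : ℂ) = (g t).im := by
        rw [← Complex.ofReal_sub, ei]
      have eg := (Complex.re_add_im (g t)).symm
      simp only [Pi.sub_apply, RCLike.ofReal_eq_complex_ofReal]
      linear_combination (Complex.I / (z - t)) * (eg - er' - Complex.I * ei')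
    have e : cauchyInt g z * (b₁ z * (b₂ z * (b₃ z * b₄ z))) =
        V₁ * b₁ z * (b₂ z * (b₃ z * b₄ z)) - V₂ * b₂ z * (b₁ z * (b₃ z * b₄ z)) +
        Complex.I * (V₃ * b₃ z * (b₁ z * (b₂ z * b₄ z)) -
          V₄ * b₄ z * (b₁ z * (b₂ z * b₃ z))) := by
      rw [eU]; ring
    rw [e]
    refine (norm_add_le _ _).trans ?_
    rw [norm_mul, Complex.norm_I, one_mul]
    have q1 := norm_sub_le (V₁ * b₁ z * (b₂ z * (b₃ z * b₄ z))) (V₂ * b₂ z * (b₁ z * (b₃ z * b₄ z)))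
    have q2 := norm_sub_le (V₃ * b₃ z * (b₁ z * (b₂ z * b₄ z))) (V₄ * b₄ z * (b₁ z * (b₂ z * b₃ z)))
    have p1 := hm' _ _ (u₁ z hz) (hm _ _ (n₂ z hz) (hm _ _ (n₃ z hz) (n₄ z hz)))
    have p2 := hm' _ _ (u₂ z hz) (hm _ _ (n₁ z hz) (hm _ _ (n₃ z hz) (n₄ z hz)))
    have p3 := hm' _ _ (u₃ z hz) (hm _ _ (n₁ z hz) (hm _ _ (n₂ z hz) (n₄ z hz)))
    have p4 := hm' _ _ (u₄ z hz) (hm _ _ (n₁ z hz) (hm _ _ (n₂ z hz) (n₃ z hz)))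
    have : 4 / ε = 1 / ε + 1 / ε + (1 / ε + 1 / ε) := by ring
    rw [this]
    linarith
  · have hz0 : 0 < z.im := by linarith
    have q1 := norm_one_sub_mul_le (b := b₂ z * (b₃ z * b₄ z)) (n₁ z hz0)
    have q2 := norm_one_sub_mul_le (b := b₃ z * b₄ z) (n₂ z hz0)
    have q3 := norm_one_sub_mul_le (b := b₄ z) (n₃ z hz0)
    have := c₁ z hz
    have := c₂ z hz
    have := c₃ z hz
    have := c₄ z hz
    simp only [mul_add]
    linarith

/-- Boundary values of a Cauchy integral are orthogonal to analytic test functions with quadratic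
decay, as soon as they are integrable. -/
lemma integral_boundary_mul_eq_zero {F g : ℝ → ℂ} (hF : Integrable F) (hg : Integrable g)
    (hlim : ∀ᵐ x : ℝ, Tendsto (fun y : ℝ => cauchyInt g (x + y * Complex.I))
      (nhdsWithin 0 (Ioi 0)) (nhds (F x))) {W : ℂ → ℂ}
    (hW : ∀ z : ℂ, 0 ≤ z.im → DifferentiableAt ℂ W z) (hW1 : ∀ z : ℂ, 0 ≤ z.im → ‖W z‖ ≤ 1)
    {M : ℝ} (hWM : ∀ z : ℂ, 0 ≤ z.im → ‖W z‖ ≤ M / ‖z + Complex.I‖ ^ 2) :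
    ∫ x : ℝ, F x * W x = 0 := by
  rw [← norm_le_zero_iff]
  refine le_of_forall_pos_le_add fun τ hτ => ?_
  rw [zero_add]
  obtain ⟨A, hA, hmul⟩ := exists_multiplier hg
  obtain ⟨σ, hσ, hsmall⟩ := exists_integral_norm_mul_le hF hτ
  have hπ := Real.pi_pos
  set ε : ℝ := σ / (2 * π * (A + 1)) with hε
  have hε0 : 0 < ε := by positivity
  obtain ⟨b, hbd, hb1, hUb, hbA⟩ := hmul ε hε0
  have hM0 : 0 ≤ M := by
    have h1 := (norm_nonneg _).trans (hWM 0 (by simp))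
    simpa using h1
  have hWc : Continuous fun x : ℝ => W x := continuous_iff_continuousAt.2 fun x =>
    ContinuousAt.comp (f := fun x : ℝ => (x : ℂ)) (hW x (by simp)).continuousAt (by fun_prop)
  set y : ℕ → ℝ := fun n => 1 / ((n : ℝ) + 1) with hy
  have hy0 : ∀ n, 0 < y n := fun n => by positivity
  have hylim : Tendsto y atTop (nhdsWithin 0 (Ioi 0)) :=
    tendsto_nhdsWithin_iff.2 ⟨tendsto_one_div_add_atTop_nhds_zero_nat,
      Eventually.of_forall fun n => hy0 n⟩
  have him : ∀ (z : ℂ) n, (z + y n * Complex.I).im = z.im + y n := fun z n => by simp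
  have hbdiff : ∀ n (z : ℂ), -y n < z.im →
      DifferentiableAt ℂ (fun z => b (z + y n * Complex.I)) z := fun n z hz =>
    DifferentiableAt.comp z (g := b) (f := fun z => z + y n * Complex.I)
      (hbd _ (by rw [him]; linarith)) (by fun_prop)
  have hbn : ∀ n (z : ℂ), 0 ≤ z.im → ‖b (z + y n * Complex.I)‖ ≤ 1 := fun n z hz =>
    hb1 _ (by rw [him]; linarith [hy0 n])
  have hbc : ∀ n, Continuous fun x : ℝ => b (x + y n * Complex.I) := fun n =>
    continuous_iff_continuousAt.2 fun x =>
      ContinuousAt.comp (f := fun x : ℝ => (x : ℂ)) (g := fun z => b (z + y n * Complex.I))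
        (hbdiff n x (by simpa using hy0 n)).continuousAt (by fun_prop)
  have hHd : ∀ n (z : ℂ), 0 ≤ z.im → DifferentiableAt ℂ
      (fun z => cauchyInt g (z + y n * Complex.I) * b (z + y n * Complex.I) * W z) z := by
    intro n z hz
    refine DifferentiableAt.mul (DifferentiableAt.mul ?_ (hbdiff n z (by linarith [hy0 n])))
      (hW z hz)
    exact DifferentiableAt.comp z (g := cauchyInt g) (f := fun z => z + y n * Complex.I)
      (differentiableAt_cauchyInt hg (by rw [him]; linarith [hy0 n])) (by fun_prop)
  have hHM : ∀ n (z : ℂ), 0 ≤ z.im →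
      ‖cauchyInt g (z + y n * Complex.I) * b (z + y n * Complex.I) * W z‖ ≤
        (4 / ε * M) / ‖z + Complex.I‖ ^ 2 := by
    intro n z hz
    rw [norm_mul, mul_div_assoc]
    have h1 := hUb (z + y n * Complex.I) (by rw [him]; linarith [hy0 n])
    have h2 := hWM z hz
    gcongr
  have hH0 := fun n => integral_eq_zero_of_decay (hHd n) (hHM n)
  have hHi := fun n => integrable_of_decay (hHd n) (hHM n)
  have hFW : Integrable fun x : ℝ => F x * W x :=
    hF.mul_bdd (c := 1) hWc.aestronglyMeasurable (Eventually.of_forall fun x => hW1 x (by simp))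
  have hFWb : ∀ n, Integrable fun x : ℝ => F x * W x * b (x + y n * Complex.I) := fun n =>
    hFW.mul_bdd (c := 1) (hbc n).aestronglyMeasurable
      (Eventually.of_forall fun x => hbn n x (by simp))
  have hD : ∀ n, Integrable fun x : ℝ => F x * W x * b (x + y n * Complex.I) -
      cauchyInt g (x + y n * Complex.I) * b (x + y n * Complex.I) * W x := fun n =>
    (hFWb n).sub (hHi n)
  have hFWs : ∀ n, Integrable fun x : ℝ => F x * W x * (1 - b (x + y n * Complex.I)) := fun n => by
    refine (hFW.sub (hFWb n)).congr (Eventually.of_forall fun x => ?_)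
    simp only [Pi.sub_apply]; ring
  have hlim0 : Tendsto (fun n => ∫ x : ℝ, (F x * W x * b (x + y n * Complex.I) -
      cauchyInt g (x + y n * Complex.I) * b (x + y n * Complex.I) * W x)) atTop (nhds 0) := by
    rw [← integral_zero ℝ ℂ (μ := volume)]
    refine tendsto_integral_of_dominated_convergence
      (fun x => ‖F x‖ + 4 / ε * M * (1 + x ^ 2)⁻¹) (fun n => (hD n).aestronglyMeasurable)
      (hF.norm.add (integrable_inv_one_add_sq.const_mul _))
      (fun n => Eventually.of_forall fun x => ?_) ?_
    · refine (norm_sub_le _ _).trans (add_le_add ?_ ?_)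
      · rw [norm_mul, norm_mul]
        calc ‖F x‖ * ‖W x‖ * ‖b (x + y n * Complex.I)‖ ≤ ‖F x‖ * 1 * 1 := by
              gcongr
              · exact hW1 x (by simp)
              · exact hbn n x (by simp)
          _ = _ := by ring
      · have := hHM n x (by simp)
        rwa [norm_ofReal_add_I_sq, div_eq_mul_inv] at this
    · filter_upwards [hlim] with x hx
      have h1 : Tendsto (fun n => cauchyInt g (x + y n * Complex.I)) atTop (nhds (F x)) :=
        hx.comp hylim
      have h2 : Tendsto (fun n => ‖F x - cauchyInt g (x + y n * Complex.I)‖) atTop (nhds 0) := by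
        have := (tendsto_const_nhds (x := F x)).sub h1
        rw [sub_self] at this
        simpa using this.norm
      refine squeeze_zero_norm (fun n => ?_) h2
      have e : F x * W x * b (x + y n * Complex.I) -
          cauchyInt g (x + y n * Complex.I) * b (x + y n * Complex.I) * W x =
          (F x - cauchyInt g (x + y n * Complex.I)) * b (x + y n * Complex.I) * W x := by ring
      rw [e, norm_mul, norm_mul]
      calc _ ≤ ‖F x - cauchyInt g (x + y n * Complex.I)‖ * 1 * 1 := by
            gcongr
            · exact hbn n x (by simp)
            · exact hW1 x (by simp)
        _ = _ := by ring
  have hbound : ∀ n, ‖∫ x : ℝ, F x * W x‖ ≤ τ + ‖∫ x : ℝ, (F x * W x * b (x + y n * Complex.I) -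
      cauchyInt g (x + y n * Complex.I) * b (x + y n * Complex.I) * W x)‖ := by
    intro n
    have e : ∫ x : ℝ, F x * W x = (∫ x : ℝ, F x * W x * (1 - b (x + y n * Complex.I))) +
        ∫ x : ℝ, (F x * W x * b (x + y n * Complex.I) -
          cauchyInt g (x + y n * Complex.I) * b (x + y n * Complex.I) * W x) := by
      rw [integral_sub (hFWb n) (hHi n), hH0 n, sub_zero, ← integral_add (hFWs n) (hFWb n)]
      congr 1; funext x; ring
    rw [e]
    refine (norm_add_le _ _).trans (add_le_add_left ?_ _)
    have hs := hsmall (fun x => 1 - b (x + y n * Complex.I)) (continuous_const.sub (hbc n))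
      (fun x => by
        have := norm_sub_le 1 (b (x + y n * Complex.I))
        rw [norm_one] at this
        linarith [hbn n x (by simp)]) ?_
    · refine (norm_integral_le_of_norm_le ?_ (Eventually.of_forall fun x => ?_)).trans hs
      · refine hF.norm.mul_bdd (c := 2) (continuous_const.sub (hbc n)).norm.aestronglyMeasurable
          (Eventually.of_forall fun x => ?_)
        have := norm_sub_le 1 (b (x + y n * Complex.I))
        rw [norm_one] at this
        rw [norm_norm]
        linarith [hbn n x (by simp)]
      · rw [norm_mul, norm_mul]
        calc _ ≤ ‖F x‖ * 1 * ‖1 - b (x + y n * Complex.I)‖ := by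
              gcongr
              exact hW1 x (by simp)
          _ = _ := by ring
    · refine (integral_norm_one_sub_sq_le (hy0 n) (hbdiff n) (hbn n)).trans ?_
      have h1 := hbA (Complex.I + y n * Complex.I) (by rw [him]; simp [(hy0 n).le])
      calc 2 * π * ‖1 - b (Complex.I + y n * Complex.I)‖ ≤ 2 * π * (ε * (A + 1)) := by
            gcongr
            nlinarith
        _ = σ := by rw [hε]; field_simp
  have := le_of_tendsto_of_tendsto' tendsto_const_nhds (tendsto_const_nhds.add hlim0.norm) hbound
  simpa using this

/-- If the boundary values of a Cauchy integral on the upper half-plane are integrable, then their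
Fourier transform is supported on the half-line. -/
theorem fourierInt_boundary_eq_zero {F g : ℝ → ℂ} (hF : Integrable F) (hg : Integrable g)
    (hlim : ∀ᵐ x : ℝ, Tendsto (fun y : ℝ => cauchyInt g (x + y * Complex.I))
      (nhdsWithin 0 (Ioi 0)) (nhds (F x))) {ξ : ℝ} (hξ : ξ < 0) : fourierInt F ξ = 0 := by
  set e : ℂ → ℂ := fun z => Complex.exp (-(ξ * z) * Complex.I) with he
  set η : ℕ → ℝ := fun n => 1 / ((n : ℝ) + 1) with hη
  have hη0 : ∀ n, 0 < η n := fun n => by positivity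
  have hη1 : ∀ n, η n ≤ 1 := fun n => by
    rw [hη, div_le_one (by positivity)]
    have : (0 : ℝ) ≤ n := by positivity
    linarith
  have hηlim : Tendsto η atTop (nhds 0) := tendsto_one_div_add_atTop_nhds_zero_nat
  set k : ℕ → ℂ → ℂ := fun n z => ((1 - Complex.I * η n * z) ^ 2)⁻¹ with hk
  have hk1 : ∀ n (z : ℂ), 0 ≤ z.im → 1 ≤ ‖1 - Complex.I * η n * z‖ := by
    intro n z hz
    have := one_le_norm_one_add (w := -(Complex.I * η n * z)) (by
      simp; exact mul_nonneg (hη0 n).le hz)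
    rwa [← sub_eq_add_neg] at this
  have hk2 : ∀ n (z : ℂ), 0 ≤ z.im → η n * ‖z + Complex.I‖ ≤ ‖1 - Complex.I * η n * z‖ := by
    intro n z hz
    have h0 := hη0 n
    have h1 := hη1 n
    have h2 : 0 ≤ η n * z.im := by positivity
    rw [← sq_le_sq₀ (by positivity) (norm_nonneg _), mul_pow, ← Complex.normSq_eq_norm_sq,
      ← Complex.normSq_eq_norm_sq, Complex.normSq_apply, Complex.normSq_apply]
    simp
    nlinarith
  have hke : ∀ z : ℂ, 0 ≤ z.im → ‖e z‖ ≤ 1 := by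
    intro z hz
    rw [he, Complex.norm_exp, Real.exp_le_one_iff]
    simp
    nlinarith
  have hkn : ∀ n (z : ℂ), 0 ≤ z.im → ‖k n z‖ ≤ 1 := fun n z hz => by
    rw [hk, norm_inv, norm_pow]
    exact inv_le_one_of_one_le₀ (one_le_pow₀ (hk1 n z hz))
  have hzero : ∀ n, ∫ x : ℝ, F x * (k n x * e x) = 0 := by
    intro n
    refine integral_boundary_mul_eq_zero hF hg hlim (W := fun z => k n z * e z)
      (M := 1 / η n ^ 2) ?_ ?_ ?_
    · intro z hz
      have hne : (1 - Complex.I * η n * z) ^ 2 ≠ 0 :=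
        pow_ne_zero 2 (norm_pos_iff.1 (one_pos.trans_le (hk1 n z hz)))
      refine DifferentiableAt.mul (DifferentiableAt.inv (by fun_prop) hne) (by fun_prop)
    · intro z hz
      rw [norm_mul]
      exact mul_le_one₀ (hkn n z hz) (norm_nonneg _) (hke z hz)
    · intro z hz
      have h1 := one_le_norm_add_I hz
      have h0 := hη0 n
      rw [norm_mul, hk, norm_inv, norm_pow, div_div, ← mul_pow, one_div]
      calc _ ≤ ((η n * ‖z + Complex.I‖) ^ 2)⁻¹ * 1 := by
            gcongr
            · exact hk2 n z hz
            · exact hke z hz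
        _ = _ := by ring
  have hkc : ∀ n, Continuous fun x : ℝ => k n x * e x := fun n => by
    have : ∀ x : ℝ, (1 - Complex.I * η n * x) ^ 2 ≠ 0 := fun x =>
      pow_ne_zero 2 (norm_pos_iff.1 (one_pos.trans_le (hk1 n x (by simp))))
    exact Continuous.mul (Continuous.inv₀ (by fun_prop) this) (by fun_prop)
  have hconv : Tendsto (fun n => ∫ x : ℝ, F x * (k n x * e x)) atTop
      (nhds (∫ x : ℝ, F x * e x)) := by
    refine tendsto_integral_of_dominated_convergence (fun x => ‖F x‖)
      (fun n => hF.aestronglyMeasurable.mul (hkc n).aestronglyMeasurable) hF.norm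
      (fun n => Eventually.of_forall fun x => ?_) (Eventually.of_forall fun x => ?_)
    · rw [norm_mul, norm_mul]
      calc ‖F x‖ * (‖k n x‖ * ‖e x‖) ≤ ‖F x‖ * (1 * 1) := by
            gcongr
            · exact hkn n x (by simp)
            · exact hke x (by simp)
        _ = _ := by ring
    · have h1 : Tendsto (fun n => k n x) atTop (nhds 1) := by
        have h2 : Tendsto (fun n => ((η n : ℝ) : ℂ)) atTop (nhds ((0 : ℝ) : ℂ)) :=
          (Complex.continuous_ofReal.tendsto 0).comp hηlim
        have h3 : Tendsto (fun n => (1 - Complex.I * η n * x) ^ 2) atTop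
            (nhds ((1 - Complex.I * ((0 : ℝ) : ℂ) * x) ^ 2)) :=
          (tendsto_const_nhds.sub ((tendsto_const_nhds.mul h2).mul tendsto_const_nhds)).pow 2
        have h4 := h3.inv₀ (by simp)
        simpa using h4
      have := (tendsto_const_nhds (x := F x)).mul (h1.mul (tendsto_const_nhds (x := e x)))
      simpa using this
  have h0 : ∫ x : ℝ, F x * e x = 0 := by
    simp only [hzero] at hconv
    exact tendsto_nhds_unique hconv tendsto_const_nhds
  rw [fourierInt, ← h0]
  congr 1
  funext x
  simp [he]

end CauchyIntegral

section BoundaryValues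

lemma tendsto_integral_mul_comp_mul {κ : ℝ → ℝ} (hκ : IntegrableOn κ (Ioi 0)) {B : ℝ → ℂ} {L : ℂ}
    {N : ℝ} (hB : Tendsto B (nhdsWithin 0 (Ioi 0)) (nhds L)) (hN : ∀ r > 0, ‖B r‖ ≤ N / r)
    (hm : ∀ y > 0, AEStronglyMeasurable (fun ρ => (κ ρ : ℂ) * B (y * ρ))
      (volume.restrict (Ioi 0))) :
    Tendsto (fun y : ℝ => ∫ ρ in Ioi (0 : ℝ), (κ ρ : ℂ) * B (y * ρ)) (nhdsWithin 0 (Ioi 0))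
      (nhds (((∫ ρ in Ioi (0 : ℝ), κ ρ : ℝ) : ℂ) * L)) := by
  obtain ⟨M, hM⟩ : ∃ M, ∀ r > 0, ‖B r‖ ≤ M := by
    have h1 : ∀ᶠ r in nhdsWithin (0 : ℝ) (Ioi 0), ‖B r‖ ≤ ‖L‖ + 1 :=
      hB.norm.eventually (eventually_le_nhds (by linarith))
    obtain ⟨δ, hδ, hδ'⟩ := mem_nhdsGT_iff_exists_Ioo_subset.1 h1
    have hδ0 : 0 < δ := hδ
    have hN0 : 0 ≤ N := by
      have := (norm_nonneg _).trans (hN 1 one_pos)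
      simpa using this
    refine ⟨max (‖L‖ + 1) (N / δ), fun r hr => ?_⟩
    rcases lt_or_ge r δ with h | h
    · exact (hδ' ⟨hr, h⟩).trans (le_max_left _ _)
    · refine (hN r hr).trans (le_trans ?_ (le_max_right _ _))
      gcongr
  rw [← integral_complex_ofReal, ← integral_mul_const]
  refine tendsto_integral_filter_of_dominated_convergence (fun ρ => ‖κ ρ‖ * M) ?_ ?_
    (hκ.norm.mul_const _) ?_
  · filter_upwards [self_mem_nhdsWithin] with y hy using hm y hy
  · filter_upwards [self_mem_nhdsWithin] with y hy
    filter_upwards [ae_restrict_mem measurableSet_Ioi] with ρ hρ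
    rw [norm_mul, Complex.norm_real]
    gcongr
    exact hM _ (mul_pos hy hρ)
  · filter_upwards [ae_restrict_mem measurableSet_Ioi] with ρ hρ
    refine tendsto_const_nhds.mul (hB.comp ?_)
    refine tendsto_nhdsWithin_iff.2 ⟨?_, ?_⟩
    · have : Tendsto (fun y : ℝ => y * ρ) (nhds 0) (nhds (0 * ρ)) :=
        tendsto_id.mul tendsto_const_nhds
      rw [zero_mul] at this
      exact this.mono_left nhdsWithin_le_nhds
    · filter_upwards [self_mem_nhdsWithin] with y hy
      exact mul_pos (mem_Ioi.1 hy) (mem_Ioi.1 hρ)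

/-- Fubini for a product integrated over a measurable region. -/
lemma integral_mul_region_swap {μ ν : Measure ℝ} [SFinite μ] [SFinite ν] {h : ℝ → ℂ} {κ : ℝ → ℝ}
    {P : ℝ → ℝ → Prop} [∀ s ρ, Decidable (P s ρ)] (hP : MeasurableSet {p : ℝ × ℝ | P p.1 p.2})
    (hh : AEStronglyMeasurable h μ) (hκ : Integrable κ ν) (h0 : ∀ᵐ ρ ∂ν, 0 ≤ κ ρ)
    (hint : Integrable (fun s => ‖h s‖ * ∫ ρ, (if P s ρ then κ ρ else 0) ∂ν) μ) :
    (∫ s, h s * ((∫ ρ, (if P s ρ then κ ρ else 0) ∂ν : ℝ) : ℂ) ∂μ =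
      ∫ ρ, (κ ρ : ℂ) * ∫ s, (if P s ρ then h s else 0) ∂μ ∂ν) ∧
    AEStronglyMeasurable (fun ρ => (κ ρ : ℂ) * ∫ s, (if P s ρ then h s else 0) ∂μ) ν := by
  set f : ℝ × ℝ → ℂ := {p : ℝ × ℝ | P p.1 p.2}.indicator fun p => h p.1 * (κ p.2 : ℂ) with hf
  have hfm : AEStronglyMeasurable f (μ.prod ν) := by
    refine AEStronglyMeasurable.indicator ?_ hP
    exact hh.comp_fst.mul
      ((Complex.continuous_ofReal.comp_aestronglyMeasurable hκ.aestronglyMeasurable).comp_snd)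
  have hfs : ∀ s ρ, f (s, ρ) = h s * ((if P s ρ then κ ρ else 0 : ℝ) : ℂ) := by
    intro s ρ
    by_cases hm : P s ρ <;> simp [hf, hm]
  have hfr : ∀ s ρ, f (s, ρ) = (κ ρ : ℂ) * (if P s ρ then h s else 0) := by
    intro s ρ
    by_cases hm : P s ρ <;> simp [hf, hm, mul_comm]
  have hfn : ∀ s, ∫ ρ, ‖f (s, ρ)‖ ∂ν = ‖h s‖ * ∫ ρ, (if P s ρ then κ ρ else 0) ∂ν := by
    intro s
    rw [← integral_const_mul]
    refine integral_congr_ae ?_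
    filter_upwards [h0] with ρ hρ
    rw [hfs, norm_mul, Complex.norm_of_nonneg]
    split_ifs
    · exact hρ
    · exact le_rfl
  have hfi : Integrable f (μ.prod ν) := by
    refine (integrable_prod_iff hfm).2 ⟨Eventually.of_forall fun s => ?_, ?_⟩
    · have hi : Integrable (fun ρ => if P s ρ then κ ρ else 0) ν := by
        have : (fun ρ => if P s ρ then κ ρ else 0) = {ρ | P s ρ}.indicator κ := by
          funext ρ; by_cases hm : P s ρ <;> simp [hm]
        rw [this]
        exact hκ.indicator (measurable_prodMk_left hP)
      simp only [hfs]
      exact (hi.ofReal (𝕜 := ℂ)).const_mul _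
    · simp only [hfn]
      exact hint
  have e2 : ∀ ρ, (κ ρ : ℂ) * (∫ s, (if P s ρ then h s else 0) ∂μ) = ∫ s, f (s, ρ) ∂μ := by
    intro ρ
    simp only [hfr]
    rw [integral_const_mul]
  have e1 : ∀ s, h s * ((∫ ρ, (if P s ρ then κ ρ else 0) ∂ν : ℝ) : ℂ) = ∫ ρ, f (s, ρ) ∂ν := by
    intro s
    simp only [hfs]
    rw [integral_const_mul, integral_complex_ofReal]
  simp only [e2, e1]
  exact ⟨integral_integral_swap (f := fun s ρ => f (s, ρ)) hfi,
    hfi.integral_prod_right.aestronglyMeasurable⟩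

lemma hasDerivAt_neg_inv_one_add_sq (ρ : ℝ) :
    HasDerivAt (fun ρ : ℝ => -(1 + ρ ^ 2)⁻¹) (2 * ρ / (1 + ρ ^ 2) ^ 2) ρ := by
  have h := (((hasDerivAt_id ρ).pow 2).const_add 1).inv (by simp; positivity)
  have e : 2 * ρ / (1 + ρ ^ 2) ^ 2 =
      -(-(((2 : ℕ) : ℝ) * id ρ ^ (2 - 1) * 1) / (1 + id ρ ^ 2) ^ 2) := by
    simp only [id]; push_cast; ring
  rw [e]
  exact h.neg

lemma tendsto_neg_inv_one_add_sq : Tendsto (fun ρ : ℝ => -(1 + ρ ^ 2)⁻¹) atTop (nhds 0) := by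
  have h : Tendsto (fun ρ : ℝ => 1 + ρ ^ 2) atTop atTop :=
    tendsto_atTop_add_const_left _ _ (tendsto_pow_atTop two_ne_zero)
  simpa using h.inv_tendsto_atTop.neg

lemma integrableOn_kernel : IntegrableOn (fun ρ : ℝ => 2 * ρ / (1 + ρ ^ 2) ^ 2) (Ioi 0) :=
  integrableOn_Ioi_deriv_of_nonneg' (fun ρ _ => hasDerivAt_neg_inv_one_add_sq ρ)
    (fun ρ hρ => by have : (0 : ℝ) < ρ := hρ; positivity) tendsto_neg_inv_one_add_sq

lemma integral_kernel_Ioi {a : ℝ} (ha : 0 ≤ a) :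
    ∫ ρ in Ioi a, 2 * ρ / (1 + ρ ^ 2) ^ 2 = (1 + a ^ 2)⁻¹ := by
  rw [integral_Ioi_of_hasDerivAt_of_nonneg' (fun ρ _ => hasDerivAt_neg_inv_one_add_sq ρ)
    (fun ρ hρ => by have : (0 : ℝ) < ρ := ha.trans_lt hρ; positivity) tendsto_neg_inv_one_add_sq]
  ring

lemma hasDerivAt_arctan_sub (ρ : ℝ) : HasDerivAt (fun ρ : ℝ => arctan ρ - ρ * (1 + ρ ^ 2)⁻¹)
    (2 * ρ / (1 + ρ ^ 2) ^ 2 * ρ) ρ := by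
  have h := (hasDerivAt_arctan ρ).add
    ((hasDerivAt_id ρ).mul (hasDerivAt_neg_inv_one_add_sq ρ))
  have e : 2 * ρ / (1 + ρ ^ 2) ^ 2 * ρ =
      1 / (1 + ρ ^ 2) + (1 * -(1 + ρ ^ 2)⁻¹ + id ρ * (2 * ρ / (1 + ρ ^ 2) ^ 2)) := by
    simp only [id]; field_simp; ring
  rw [e]
  refine h.congr_of_eventuallyEq (Eventually.of_forall fun s => ?_)
  simp [sub_eq_add_neg]

lemma tendsto_arctan_sub :
    Tendsto (fun ρ : ℝ => arctan ρ - ρ * (1 + ρ ^ 2)⁻¹) atTop (nhds (π / 2)) := by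
  have h1 : Tendsto arctan atTop (nhds (π / 2)) := tendsto_nhds_of_tendsto_nhdsWithin tendsto_arctan_atTop
  have h2 : Tendsto (fun ρ : ℝ => ρ * (1 + ρ ^ 2)⁻¹) atTop (nhds 0) := by
    refine squeeze_zero' ?_ ?_ tendsto_inv_atTop_zero
    · filter_upwards [eventually_gt_atTop 0] with ρ hρ
      positivity
    · filter_upwards [eventually_gt_atTop 0] with ρ hρ
      rw [← div_eq_mul_inv, div_le_iff₀ (by positivity)]
      field_simp
      nlinarith
  simpa using h1.sub h2

lemma integrableOn_kernel_mul :
    IntegrableOn (fun ρ : ℝ => 2 * ρ / (1 + ρ ^ 2) ^ 2 * ρ) (Ioi 0) :=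
  integrableOn_Ioi_deriv_of_nonneg' (fun ρ _ => hasDerivAt_arctan_sub ρ)
    (fun ρ hρ => by have : (0 : ℝ) < ρ := hρ; positivity) tendsto_arctan_sub

lemma integral_kernel_mul : ∫ ρ in Ioi (0 : ℝ), 2 * ρ / (1 + ρ ^ 2) ^ 2 * ρ = π / 2 := by
  rw [integral_Ioi_of_hasDerivAt_of_nonneg' (fun ρ _ => hasDerivAt_arctan_sub ρ)
    (fun ρ hρ => by have : (0 : ℝ) < ρ := hρ; positivity) tendsto_arctan_sub]
  simp

lemma integral_kernel_ge {y s : ℝ} (hy : 0 < y) (hs : 0 < s) :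
    (∫ ρ in Ioi (0 : ℝ), if s ≤ y * ρ then 2 * ρ / (1 + ρ ^ 2) ^ 2 else 0) =
      y ^ 2 / (s ^ 2 + y ^ 2) := by
  have h1 : (fun ρ : ℝ => if s ≤ y * ρ then 2 * ρ / (1 + ρ ^ 2) ^ 2 else 0) =
      (Ici (s / y)).indicator fun ρ => 2 * ρ / (1 + ρ ^ 2) ^ 2 := by
    funext ρ
    simp only [indicator, mem_Ici, div_le_iff₀' hy]
  have h2 : Ioi (0 : ℝ) ∩ Ici (s / y) = Ici (s / y) :=
    inter_eq_right.2 fun ρ hρ => (div_pos hs hy).trans_le hρ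
  rw [h1, setIntegral_indicator measurableSet_Ici, h2, integral_Ici_eq_integral_Ioi,
    integral_kernel_Ioi (by positivity)]
  field_simp
  ring

lemma integral_kernel_lt {y s : ℝ} (hy : 0 < y) (hs : 0 < s) :
    (∫ ρ in Ioi (0 : ℝ), if y * ρ < s then 2 * ρ / (1 + ρ ^ 2) ^ 2 else 0) =
      s ^ 2 / (s ^ 2 + y ^ 2) := by
  have hm : MeasurableSet {ρ : ℝ | s ≤ y * ρ} := measurableSet_le (by fun_prop) (by fun_prop)
  have hi : IntegrableOn (fun ρ : ℝ => if s ≤ y * ρ then 2 * ρ / (1 + ρ ^ 2) ^ 2 else 0)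
      (Ioi 0) := Integrable.indicator (s := {ρ : ℝ | s ≤ y * ρ}) integrableOn_kernel hm
  have h := integral_sub integrableOn_kernel hi
  rw [integral_kernel_ge hy hs, integral_kernel_Ioi le_rfl] at h
  have e : (1 + (0 : ℝ) ^ 2)⁻¹ - y ^ 2 / (s ^ 2 + y ^ 2) = s ^ 2 / (s ^ 2 + y ^ 2) := by
    field_simp; ring
  rw [← e, ← h]
  congr 1
  funext ρ
  by_cases hρ : s ≤ y * ρ
  · simp [hρ, hρ.not_gt]
  · simp [hρ, not_le.1 hρ]

lemma tendsto_conjugate_poisson {φ : ℝ → ℂ} (hφ : IntegrableOn φ (Ioi 0)) {L : ℂ}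
    (hL : Tendsto (fun δ : ℝ => ∫ s in Ioi δ, φ s / s) (nhdsWithin 0 (Ioi 0)) (nhds L)) :
    Tendsto (fun y : ℝ => ∫ s in Ioi (0 : ℝ), φ s * ((s / (s ^ 2 + y ^ 2) : ℝ) : ℂ))
      (nhdsWithin 0 (Ioi 0)) (nhds L) := by
  have hN : ∀ r > 0, ‖∫ s in Ioi r, φ s / s‖ ≤ (∫ s in Ioi (0 : ℝ), ‖φ s‖) / r := by
    intro r hr
    have hsub : Ioi r ⊆ Ioi 0 := Ioi_subset_Ioi hr.le
    calc ‖∫ s in Ioi r, φ s / s‖ ≤ ∫ s in Ioi r, ‖φ s‖ / r := by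
          refine norm_integral_le_of_norm_le ((hφ.mono_set hsub).norm.div_const r) ?_
          filter_upwards [ae_restrict_mem measurableSet_Ioi] with s hs
          have hs' : r < s := hs
          rw [norm_div, Complex.norm_of_nonneg (by linarith)]
          gcongr
      _ = (∫ s in Ioi r, ‖φ s‖) / r := integral_div _ _
      _ ≤ _ := by
          have := setIntegral_mono_set hφ.norm (Eventually.of_forall fun _ => norm_nonneg _)
            hsub.eventuallyLE
          gcongr
  have hφm : AEStronglyMeasurable (fun s : ℝ => φ s / s) (volume.restrict (Ioi 0)) :=
    hφ.aestronglyMeasurable.div₀ (Measurable.aestronglyMeasurable (by fun_prop))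
  have hint : ∀ y : ℝ, 0 < y → IntegrableOn (fun s : ℝ => ‖φ s / s‖ * ∫ ρ in Ioi (0 : ℝ),
      if y * ρ < s then 2 * ρ / (1 + ρ ^ 2) ^ 2 else 0) (Ioi 0) := by
    intro y hy
    have h1 : AEStronglyMeasurable (fun s : ℝ => ‖φ s / s‖ * (s ^ 2 / (s ^ 2 + y ^ 2)))
        (volume.restrict (Ioi 0)) :=
      hφm.norm.mul (Measurable.aestronglyMeasurable (by fun_prop))
    refine (hφ.norm.div_const y).mono' (h1.congr ?_) ?_
    · filter_upwards [ae_restrict_mem measurableSet_Ioi] with s hs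
      rw [integral_kernel_lt hy hs]
    · filter_upwards [ae_restrict_mem measurableSet_Ioi] with s hs
      have hs' : (0 : ℝ) < s := hs
      rw [integral_kernel_lt hy hs, norm_mul, norm_norm, norm_div,
        Complex.norm_of_nonneg hs'.le, Real.norm_of_nonneg (by positivity)]
      calc ‖φ s‖ / s * (s ^ 2 / (s ^ 2 + y ^ 2)) = ‖φ s‖ * (s / (s ^ 2 + y ^ 2)) := by
            field_simp
        _ ≤ ‖φ s‖ * (1 / y) := by
            gcongr ?_ * ?_
            rw [div_le_div_iff₀ (by positivity) hy]
            nlinarith [sq_nonneg (s - y)]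
        _ = _ := by ring
  have hswap := fun (y : ℝ) (hy : 0 < y) =>
    integral_mul_region_swap (P := fun s ρ : ℝ => y * ρ < s)
      (measurableSet_lt (by fun_prop) (by fun_prop)) hφm integrableOn_kernel
      (by filter_upwards [ae_restrict_mem measurableSet_Ioi] with ρ hρ
          have : (0 : ℝ) < ρ := hρ
          positivity) (hint y hy)
  have hset : ∀ y > 0, ∀ ρ > 0, (∫ s in Ioi (0 : ℝ), if y * ρ < s then φ s / s else 0) =
      ∫ s in Ioi (y * ρ), φ s / s := by
    intro y hy ρ hρ
    have h2 : Ioi (0 : ℝ) ∩ Ioi (y * ρ) = Ioi (y * ρ) :=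
      inter_eq_right.2 (Ioi_subset_Ioi (by positivity))
    rw [← h2, ← setIntegral_indicator measurableSet_Ioi]
    congr 1
  have main := tendsto_integral_mul_comp_mul integrableOn_kernel hL hN (fun y hy => by
    refine (hswap y hy).2.congr ?_
    filter_upwards [ae_restrict_mem measurableSet_Ioi] with ρ hρ
    rw [hset y hy ρ hρ])
  rw [integral_kernel_Ioi le_rfl] at main
  simp only [ne_eq, OfNat.ofNat_ne_zero, not_false_eq_true, zero_pow, add_zero, inv_one,
    Complex.ofReal_one, one_mul] at main
  refine main.congr' ?_
  filter_upwards [self_mem_nhdsWithin] with y hy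
  have hy' : 0 < y := hy
  calc _ = ∫ ρ in Ioi (0 : ℝ), ((2 * ρ / (1 + ρ ^ 2) ^ 2 : ℝ) : ℂ) *
        ∫ s in Ioi (0 : ℝ), if y * ρ < s then φ s / s else 0 :=
        setIntegral_congr_fun measurableSet_Ioi fun ρ hρ => by
          simp only [hset y hy ρ hρ]
    _ = _ := (hswap y hy).1.symm
    _ = _ := by
        refine setIntegral_congr_fun measurableSet_Ioi fun s hs => ?_
        have hs' : (0 : ℝ) < s := hs
        have h1 : (s : ℂ) ≠ 0 := by exact_mod_cast hs'.ne'
        simp only [integral_kernel_lt hy hs]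
        push_cast
        field_simp

lemma tendsto_poisson {ψ : ℝ → ℂ} (hψ : IntegrableOn ψ (Ioi 0)) {L : ℂ}
    (hL : Tendsto (fun δ : ℝ => (∫ s in Ioc 0 δ, ψ s) / δ) (nhdsWithin 0 (Ioi 0)) (nhds L)) :
    Tendsto (fun y : ℝ => ∫ s in Ioi (0 : ℝ), ψ s * ((y / (s ^ 2 + y ^ 2) : ℝ) : ℂ))
      (nhdsWithin 0 (Ioi 0)) (nhds ((π / 2 : ℝ) * L)) := by
  have hN : ∀ r > 0, ‖(∫ s in Ioc 0 r, ψ s) / r‖ ≤ (∫ s in Ioi (0 : ℝ), ‖ψ s‖) / r := by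
    intro r hr
    rw [norm_div, Complex.norm_of_nonneg hr.le]
    have h1 := norm_integral_le_integral_norm (μ := volume.restrict (Ioc 0 r)) ψ
    have h2 := setIntegral_mono_set hψ.norm (Eventually.of_forall fun _ => norm_nonneg _)
      (show Ioc 0 r ⊆ Ioi 0 from Ioc_subset_Ioi_self).eventuallyLE
    have h3 := h1.trans h2
    gcongr
  have hint : ∀ y : ℝ, 0 < y → IntegrableOn (fun s : ℝ => ‖ψ s‖ * ∫ ρ in Ioi (0 : ℝ),
      if s ≤ y * ρ then 2 * ρ / (1 + ρ ^ 2) ^ 2 else 0) (Ioi 0) := by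
    intro y hy
    have h1 : AEStronglyMeasurable (fun s : ℝ => ‖ψ s‖ * (y ^ 2 / (s ^ 2 + y ^ 2)))
        (volume.restrict (Ioi 0)) :=
      hψ.aestronglyMeasurable.norm.mul (Measurable.aestronglyMeasurable (by fun_prop))
    refine hψ.norm.mono' (h1.congr ?_) ?_
    · filter_upwards [ae_restrict_mem measurableSet_Ioi] with s hs
      rw [integral_kernel_ge hy hs]
    · filter_upwards [ae_restrict_mem measurableSet_Ioi] with s hs
      rw [integral_kernel_ge hy hs, norm_mul, norm_norm, Real.norm_of_nonneg (by positivity)]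
      refine mul_le_of_le_one_right (norm_nonneg _) ?_
      rw [div_le_one (by positivity)]
      nlinarith [sq_nonneg s]
  have hswap := fun (y : ℝ) (hy : 0 < y) =>
    integral_mul_region_swap (P := fun s ρ : ℝ => s ≤ y * ρ)
      (measurableSet_le (by fun_prop) (by fun_prop)) hψ.aestronglyMeasurable integrableOn_kernel
      (by filter_upwards [ae_restrict_mem measurableSet_Ioi] with ρ hρ
          have : (0 : ℝ) < ρ := hρ
          positivity) (hint y hy)
  have hset : ∀ y > 0, ∀ ρ > 0, ((2 * ρ / (1 + ρ ^ 2) ^ 2 : ℝ) : ℂ) *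
      (∫ s in Ioi (0 : ℝ), if s ≤ y * ρ then ψ s else 0) =
      y * (((2 * ρ / (1 + ρ ^ 2) ^ 2 * ρ : ℝ) : ℂ) *
        ((∫ s in Ioc 0 (y * ρ), ψ s) / ((y * ρ : ℝ) : ℂ))) := by
    intro y hy ρ hρ
    rw [← Ioi_inter_Iic, ← setIntegral_indicator measurableSet_Iic]
    have e : (Iic (y * ρ)).indicator ψ = fun s => if s ≤ y * ρ then ψ s else 0 := by
      funext s
      simp only [indicator, mem_Iic]
    rw [e]
    have h1 : (y : ℂ) ≠ 0 := by exact_mod_cast hy.ne'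
    have h2 : (ρ : ℂ) ≠ 0 := by exact_mod_cast hρ.ne'
    push_cast
    rw [eq_comm, ← mul_div_assoc, ← mul_div_assoc, div_eq_iff (mul_ne_zero h1 h2)]
    ring
  have main := tendsto_integral_mul_comp_mul integrableOn_kernel_mul hL hN (fun y hy => by
    refine ((hswap y hy).2.const_mul (y : ℂ)⁻¹).congr ?_
    filter_upwards [ae_restrict_mem measurableSet_Ioi] with ρ hρ
    have h1 : (y : ℂ) ≠ 0 := by exact_mod_cast hy.ne'
    rw [hset y hy ρ hρ, inv_mul_cancel_left₀ h1])
  rw [integral_kernel_mul] at main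
  refine main.congr' ?_
  filter_upwards [self_mem_nhdsWithin] with y hy
  have hy' : 0 < y := hy
  have h1 : (y : ℂ) ≠ 0 := by exact_mod_cast hy'.ne'
  calc _ = ∫ ρ in Ioi (0 : ℝ), (y : ℂ)⁻¹ * (((2 * ρ / (1 + ρ ^ 2) ^ 2 : ℝ) : ℂ) *
        ∫ s in Ioi (0 : ℝ), if s ≤ y * ρ then ψ s else 0) :=
        setIntegral_congr_fun measurableSet_Ioi fun ρ hρ => by
          simp only [hset y hy ρ hρ, inv_mul_cancel_left₀ h1]
    _ = (y : ℂ)⁻¹ * ∫ s in Ioi (0 : ℝ), ψ s * _ := by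
        rw [integral_const_mul, ← (hswap y hy).1]
    _ = _ := by
        rw [← integral_const_mul]
        refine setIntegral_congr_fun measurableSet_Ioi fun s hs => ?_
        simp only [integral_kernel_ge hy hs]
        push_cast
        field_simp

lemma cauchyInt_eq {g : ℝ → ℂ} (hg : Integrable g) (x : ℝ) {y : ℝ} (hy : 0 < y) :
    cauchyInt g (x + y * Complex.I) =
      (∫ s in Ioi (0 : ℝ), (g (x + s) + g (x - s)) * ((y / (s ^ 2 + y ^ 2) : ℝ) : ℂ)) +
      Complex.I * ∫ s in Ioi (0 : ℝ), (g (x - s) - g (x + s)) * ((s / (s ^ 2 + y ^ 2) : ℝ) : ℂ) := by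
  set q : ℝ → ℂ := fun u => g (x - u) *
    (((y / (u ^ 2 + y ^ 2) : ℝ) : ℂ) + Complex.I * ((u / (u ^ 2 + y ^ 2) : ℝ) : ℂ)) with hq
  have hker : ∀ u : ℝ, Complex.I / (x + y * Complex.I - ((x - u : ℝ) : ℂ)) =
      ((y / (u ^ 2 + y ^ 2) : ℝ) : ℂ) + Complex.I * ((u / (u ^ 2 + y ^ 2) : ℝ) : ℂ) := by
    intro u
    have h1 : ((u : ℂ) ^ 2 + (y : ℂ) ^ 2) ≠ 0 := by
      have : u ^ 2 + y ^ 2 ≠ 0 := by positivity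
      exact_mod_cast this
    have h2 : (u : ℂ) + y * Complex.I ≠ 0 := fun h => by
      have := congrArg Complex.im h
      simp at this
      exact hy.ne' this
    have e : (x : ℂ) + y * Complex.I - ((x - u : ℝ) : ℂ) = u + y * Complex.I := by
      push_cast; ring
    rw [e, div_eq_iff h2]
    push_cast
    field_simp
    linear_combination (-(u : ℂ) * y) * Complex.I_sq
  have hz : 0 < ((x : ℂ) + y * Complex.I).im := by simpa using hy
  have hi0 := (integrable_cauchy hg hz).comp_sub_left x
  have hqi : Integrable q := hi0.congr (Eventually.of_forall fun u => by
    simp only [hq]; rw [← hker u])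
  have e0 : cauchyInt g (x + y * Complex.I) = ∫ u, q u := by
    rw [cauchyInt, ← integral_sub_left_eq_self _ volume x]
    congr 1
    funext u
    rw [hker u]
  have hqn : IntegrableOn (fun u => q (-u)) (Ioi 0) := hqi.comp_neg.integrableOn
  have hg1 : Integrable fun s => g (x - s) := hg.comp_sub_left x
  have hg2 : Integrable fun s => g (x + s) := hg.comp_add_left x
  have hb1 : ∀ {h : ℝ → ℂ}, Integrable h →
      IntegrableOn (fun s => h s * ((y / (s ^ 2 + y ^ 2) : ℝ) : ℂ)) (Ioi 0) := fun {h} hh => by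
    refine (hh.mul_bdd (c := 1 / y) (Measurable.aestronglyMeasurable (by fun_prop))
      (Eventually.of_forall fun s => ?_)).integrableOn
    rw [Complex.norm_of_nonneg (by positivity), div_le_div_iff₀ (by positivity) hy]
    nlinarith [sq_nonneg s]
  have hb2 : ∀ {h : ℝ → ℂ}, Integrable h →
      IntegrableOn (fun s => h s * ((s / (s ^ 2 + y ^ 2) : ℝ) : ℂ)) (Ioi 0) := fun {h} hh => by
    refine (hh.mul_bdd (c := 1 / y) (Measurable.aestronglyMeasurable (by fun_prop))
      (Eventually.of_forall fun s => ?_)).integrableOn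
    rw [Complex.norm_real, Real.norm_eq_abs, abs_div, abs_of_pos (by positivity : 0 < s ^ 2 + y ^ 2),
      div_le_div_iff₀ (by positivity) hy]
    nlinarith [sq_nonneg (|s| - y), sq_abs s, sq_nonneg s, abs_nonneg s]
  rw [e0, ← intervalIntegral.integral_Iic_add_Ioi hqi.integrableOn hqi.integrableOn (b := 0)]
  have e1 : ∫ u in Iic (0 : ℝ), q u = ∫ u in Ioi (0 : ℝ), q (-u) := by
    simp
  have hA : IntegrableOn (fun s => (g (x + s) + g (x - s)) * ((y / (s ^ 2 + y ^ 2) : ℝ) : ℂ))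
      (Ioi 0) := hb1 (hg2.add hg1)
  have hB : IntegrableOn (fun s => (g (x - s) - g (x + s)) * ((s / (s ^ 2 + y ^ 2) : ℝ) : ℂ))
      (Ioi 0) := hb2 (hg1.sub hg2)
  rw [e1, ← integral_add hqn hqi.integrableOn, ← integral_const_mul,
    ← integral_add hA (hB.const_mul _)]
  congr 1
  funext s
  simp only [hq, neg_sq, sub_neg_eq_add, neg_div, Complex.ofReal_neg]
  ring

/-- Almost everywhere boundary values of a Cauchy integral, whenever the principal value exists. -/
theorem ae_tendsto_cauchyInt {g H : ℝ → ℂ} (hg : Integrable g)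
    (hH : ∀ᵐ x : ℝ, Tendsto (fun δ : ℝ => ∫ s in Ioi δ, (g (x - s) - g (x + s)) / s)
      (nhdsWithin 0 (Ioi 0)) (nhds (H x))) :
    ∀ᵐ x : ℝ, Tendsto (fun y : ℝ => cauchyInt g (x + y * Complex.I)) (nhdsWithin 0 (Ioi 0))
      (nhds (π * g x + Complex.I * H x)) := by
  filter_upwards [hH, LocallyIntegrable.ae_hasDerivAt_integral hg.locallyIntegrable] with x hx hd
  have hg1 : Integrable fun s => g (x - s) := hg.comp_sub_left x
  have hg2 : Integrable fun s => g (x + s) := hg.comp_add_left x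
  have hI := tendsto_conjugate_poisson (hg1.sub hg2).integrableOn hx
  have hR := tendsto_poisson (ψ := fun s => g (x + s) + g (x - s)) (hg2.add hg1).integrableOn
    (L := 2 * g x) (by
      have h1 : HasDerivAt (fun δ : ℝ => ∫ t in (0 : ℝ)..(x + δ), g t) (g x) 0 := by
        have := HasDerivAt.scomp (0 : ℝ) (h := fun δ : ℝ => x + δ) (h' := 1)
          (g₁ := fun u => ∫ t in (0 : ℝ)..u, g t) (by simpa using hd 0)
          ((hasDerivAt_id (0 : ℝ)).const_add x)
        simpa [Function.comp_def] using this
      have h2 : HasDerivAt (fun δ : ℝ => ∫ t in (0 : ℝ)..(x - δ), g t) (-g x) 0 := by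
        have := HasDerivAt.scomp (0 : ℝ) (h := fun δ : ℝ => x - δ) (h' := -1)
          (g₁ := fun u => ∫ t in (0 : ℝ)..u, g t) (by simpa using hd 0)
          ((hasDerivAt_id (0 : ℝ)).const_sub x)
        simpa [Function.comp_def] using this
      have h3 := (hasDerivAt_iff_tendsto_slope.1 (h1.sub h2)).mono_left
        (nhdsWithin_mono _ fun t (ht : 0 < t) => ht.ne')
      have e : g x - -g x = 2 * g x := by ring
      rw [e] at h3
      refine h3.congr' ?_
      filter_upwards [self_mem_nhdsWithin] with δ hδ
      have hδ' : 0 < δ := hδ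
      have hii : ∀ a b, IntervalIntegrable g volume a b := fun a b => hg.intervalIntegrable
      rw [← intervalIntegral.integral_of_le hδ'.le, intervalIntegral.integral_add
        hg2.intervalIntegrable hg1.intervalIntegrable,
        intervalIntegral.integral_comp_add_left (fun t => g t),
        intervalIntegral.integral_comp_sub_left (fun t => g t), slope_def_module]
      simp only [Pi.sub_apply, add_zero, sub_zero, sub_self]
      rw [intervalIntegral.integral_interval_sub_left (hii _ _) (hii _ _),
        ← intervalIntegral.integral_add_adjacent_intervals (hii (x - δ) x) (hii x (x + δ)),
        Complex.real_smul, Complex.ofReal_inv]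
      ring)
  have := hR.add (hI.const_mul Complex.I)
  have e : ((π / 2 : ℝ) : ℂ) * (2 * g x) = π * g x := by push_cast; ring
  rw [e] at this
  refine this.congr' ?_
  filter_upwards [self_mem_nhdsWithin] with y hy
  rw [cauchyInt_eq hg x hy]
  rfl

end BoundaryValues

section CosineTransform

lemma integral_cos_mul_eq_sin_div {x : ℝ} (hx : 0 < x) (u : ℝ) :
    ∫ t in (0 : ℝ)..u, ((Real.cos (x * t) : ℝ) : ℂ) = ((Real.sin (x * u) / x : ℝ) : ℂ) := by
  rw [intervalIntegral.integral_ofReal,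
    intervalIntegral.integral_comp_mul_left (fun t => Real.cos t) hx.ne']
  simp
  field_simp

/-- Integration by parts on `(0, N]`, in the form given by Fubini's theorem. -/
lemma integral_mul_cos_eq {f h : ℝ → ℂ}
    (hf : ∀ a b : ℝ, 0 < a → a ≤ b → f b - f a = ∫ t in a..b, h t)
    (hh : IntegrableOn h (Ioi 0)) {x : ℝ} (hx : 0 < x) {N : ℝ} (hN : 0 < N) :
    ∫ t in (0 : ℝ)..N, f t * ((Real.cos (x * t) : ℝ) : ℂ) =
      f N * ((Real.sin (x * N) / x : ℝ) : ℂ) -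
        ∫ u in (0 : ℝ)..N, h u * ((Real.sin (x * u) / x : ℝ) : ℂ) := by
  set μ : Measure ℝ := volume.restrict (Ioc 0 N) with hμ
  have hhN : Integrable h μ := hh.mono_set Ioc_subset_Ioi_self
  have hcos : Integrable (fun t : ℝ => ((Real.cos (x * t) : ℝ) : ℂ)) μ :=
    Continuous.integrableOn_Ioc (by fun_prop)
  set Φ : ℝ × ℝ → ℂ := {p : ℝ × ℝ | p.1 < p.2}.indicator
    (fun p => ((Real.cos (x * p.1) : ℝ) : ℂ) * h p.2) with hΦ
  have hΦi : Integrable Φ (μ.prod μ) :=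
    (hcos.mul_prod hhN).indicator (measurableSet_lt measurable_fst measurable_snd)
  have hswap := integral_integral_swap (f := fun t u => Φ (t, u)) hΦi
  have inner1 : ∀ t ∈ Ioc 0 N, ∫ u, Φ (t, u) ∂μ = ((Real.cos (x * t) : ℝ) : ℂ) * (f N - f t) := by
    intro t ht
    rw [hf t N ht.1 ht.2, intervalIntegral.integral_of_le ht.2, ← integral_const_mul]
    have e : (fun u => Φ (t, u)) =
        (Ioi t).indicator (fun u => ((Real.cos (x * t) : ℝ) : ℂ) * h u) := by
      funext u
      by_cases hu : t < u <;> simp [hΦ, indicator, hu]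
    rw [e, integral_indicator measurableSet_Ioi, hμ, Measure.restrict_restrict measurableSet_Ioi]
    congr 2
    ext u
    simp only [mem_inter_iff, mem_Ioi, mem_Ioc]
    exact ⟨fun h => ⟨h.1, h.2.2⟩, fun h => ⟨h.1, ht.1.trans h.1, h.2⟩⟩
  have inner2 : ∀ u ∈ Ioc 0 N, ∫ t, Φ (t, u) ∂μ = h u * ((Real.sin (x * u) / x : ℝ) : ℂ) := by
    intro u hu
    rw [← integral_cos_mul_eq_sin_div hx, intervalIntegral.integral_of_le hu.1.le,
      integral_Ioc_eq_integral_Ioo (y := u), ← integral_const_mul]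
    have e : (fun t => Φ (t, u)) =
        (Iio u).indicator (fun t => h u * ((Real.cos (x * t) : ℝ) : ℂ)) := by
      funext t
      by_cases hu : t < u <;> simp [hΦ, indicator, hu, mul_comm]
    rw [e, integral_indicator measurableSet_Iio, hμ, Measure.restrict_restrict measurableSet_Iio]
    congr 2
    ext t
    simp only [mem_inter_iff, mem_Iio, mem_Ioc, mem_Ioo]
    exact ⟨fun h => ⟨h.2.1, h.1⟩, fun h => ⟨h.2, h.1, h.2.le.trans hu.2⟩⟩
  have e1 : ∫ t, ∫ u, Φ (t, u) ∂μ ∂μ = ∫ t, ((Real.cos (x * t) : ℝ) : ℂ) * (f N - f t) ∂μ :=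
    setIntegral_congr_fun measurableSet_Ioc inner1
  have e2 : ∫ u, ∫ t, Φ (t, u) ∂μ ∂μ = ∫ u, h u * ((Real.sin (x * u) / x : ℝ) : ℂ) ∂μ :=
    setIntegral_congr_fun measurableSet_Ioc inner2
  have hi : Integrable (fun t => ((Real.cos (x * t) : ℝ) : ℂ) * (f N - f t)) μ :=
    (hΦi.integral_prod_left).congr
      ((ae_restrict_iff' measurableSet_Ioc).2 (Eventually.of_forall inner1))
  rw [intervalIntegral.integral_of_le hN.le, intervalIntegral.integral_of_le hN.le, ← hμ, ← e2,
    ← hswap, e1, ← integral_cos_mul_eq_sin_div hx, intervalIntegral.integral_of_le hN.le, ← hμ,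
    ← integral_const_mul, ← integral_sub (hcos.const_mul _) hi]
  congr 1
  funext t
  ring

lemma integrableOn_mul_sin {h : ℝ → ℂ} (hh : IntegrableOn h (Ioi 0)) (x : ℝ) :
    IntegrableOn (fun u => h u * ((Real.sin (x * u) : ℝ) : ℂ)) (Ioi 0) := by
  refine Integrable.mul_bdd (c := 1) hh (Continuous.aestronglyMeasurable (by fun_prop))
    (Eventually.of_forall fun u => ?_)
  rw [Complex.norm_real, Real.norm_eq_abs]
  exact Real.abs_sin_le_one _

/-- The improper cosine transform of `f` is the sine transform of `-f'` divided by `x`. -/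
lemma cosineTransform_eq {f h : ℝ → ℂ}
    (hf : ∀ a b : ℝ, 0 < a → a ≤ b → f b - f a = ∫ t in a..b, h t)
    (hlim : Tendsto f atTop (nhds 0)) (hh : IntegrableOn h (Ioi 0)) {x : ℝ} (hx : 0 < x) {c : ℂ}
    (hc : Tendsto (fun N : ℝ => ∫ t in (0 : ℝ)..N, f t * (Real.cos (x * t) : ℂ)) atTop (nhds c)) :
    c = -((∫ u in Ioi (0 : ℝ), h u * ((Real.sin (x * u) : ℝ) : ℂ)) / x) := by
  refine tendsto_nhds_unique hc ?_
  have h1 : Tendsto (fun N : ℝ => f N * ((Real.sin (x * N) / x : ℝ) : ℂ)) atTop (nhds 0) := by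
    have hx' := hlim.norm.mul_const (1 / x)
    rw [norm_zero, zero_mul] at hx'
    refine squeeze_zero_norm (fun N => ?_) hx'
    rw [norm_mul, Complex.norm_real, Real.norm_eq_abs, abs_div, abs_of_pos hx]
    gcongr
    exact Real.abs_sin_le_one _
  have hint : IntegrableOn (fun u => h u * ((Real.sin (x * u) / x : ℝ) : ℂ)) (Ioi 0) := by
    refine ((integrableOn_mul_sin hh x).div_const (x : ℂ)).congr (Eventually.of_forall fun u => ?_)
    push_cast
    ring
  have h2 := intervalIntegral_tendsto_integral_Ioi 0 hint tendsto_id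
  have h3 := h1.sub h2
  have e : ∫ u in Ioi (0 : ℝ), h u * ((Real.sin (x * u) / x : ℝ) : ℂ) =
      (∫ u in Ioi (0 : ℝ), h u * ((Real.sin (x * u) : ℝ) : ℂ)) / x := by
    rw [← integral_div]
    congr 1
    funext u
    push_cast
    ring
  rw [e, zero_sub] at h3
  refine h3.congr' ?_
  filter_upwards [eventually_gt_atTop 0] with N hN
  exact (integral_mul_cos_eq hf hh hx hN).symm

end CosineTransform

section OddExtension

lemma integral_eq_integral_Ioi_neg_add {q : ℝ → ℂ} (hq : Integrable q) :
    ∫ u, q u = ∫ u in Ioi (0 : ℝ), (q (-u) + q u) := by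
  have h1 := intervalIntegral.integral_Iic_add_Ioi (b := 0) hq.integrableOn hq.integrableOn
  have h2 : ∫ u in Ioi (0 : ℝ), q (-u) = ∫ u in Iic (0 : ℝ), q u := by
    simp
  rw [integral_add hq.comp_neg.integrableOn hq.integrableOn, h2, h1]

lemma integrable_of_integrableOn_Ioi {E : Type*} [NormedAddCommGroup E] {q : ℝ → E}
    (h1 : IntegrableOn q (Ioi 0)) (h2 : IntegrableOn (fun t => q (-t)) (Ioi 0)) :
    Integrable q := by
  have h3 : IntegrableOn q (Iio 0) := by
    have := IntegrableOn.comp_neg_Iio (c := 0) (f := fun t => q (-t)) (by simpa using h2)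
    simpa using this
  rw [← integrableOn_univ, ← Iic_union_Ioi (a := (0 : ℝ))]
  exact ((integrableOn_Iic_iff_integrableOn_Iio).2 h3).union h1

/-- The odd extension of a function on `(0, ∞)`. -/
noncomputable def oddExt (h : ℝ → ℂ) (t : ℝ) : ℂ :=
  if 0 < t then h t else if t < 0 then -h (-t) else 0

lemma oddExt_of_pos (h : ℝ → ℂ) {t : ℝ} (ht : 0 < t) : oddExt h t = h t := by
  simp [oddExt, ht]

lemma oddExt_neg (h : ℝ → ℂ) (t : ℝ) : oddExt h (-t) = -oddExt h t := by
  rcases lt_trichotomy t 0 with ht | rfl | ht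
  · simp [oddExt, ht, ht.not_gt]
  · simp [oddExt]
  · simp [oddExt, ht, ht.not_gt]

lemma integrable_oddExt {h : ℝ → ℂ} (hh : IntegrableOn h (Ioi 0)) : Integrable (oddExt h) := by
  refine integrable_of_integrableOn_Ioi
    (hh.congr_fun (fun t ht => (oddExt_of_pos h ht).symm) measurableSet_Ioi)
    (hh.neg.congr_fun (fun t ht => ?_) measurableSet_Ioi)
  rw [oddExt_neg, oddExt_of_pos h ht, Pi.neg_apply]

/-- The kernel expressing the part of the Hilbert transform of an odd function at `t` which comes
from the points at distance more than `t / 2` from `t`. -/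
noncomputable def tailKernel (t u : ℝ) : ℝ :=
  (if t / 2 < |u - t| then (u - t)⁻¹ else 0) + (u + t)⁻¹

lemma measurable_tailKernel : Measurable fun p : ℝ × ℝ => tailKernel p.1 p.2 := by
  unfold tailKernel
  refine Measurable.add (Measurable.ite (measurableSet_lt (by fun_prop) (by fun_prop))
    (by fun_prop) measurable_const) (by fun_prop)

lemma abs_tailKernel_le {t u : ℝ} (ht : 0 < t) (hu : 0 < u) :
    |tailKernel t u| ≤ 20 * (u / (t ^ 2 + u ^ 2)) := by
  unfold tailKernel
  rw [mul_div_assoc']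
  split_ifs with h
  · have hut : u + t ≠ 0 := by positivity
    have hne : u - t ≠ 0 := fun h0 => by
      rw [h0, abs_zero] at h
      linarith
    have e : (u - t)⁻¹ + (u + t)⁻¹ = 2 * u / ((u - t) * (u + t)) := by
      field_simp
      ring
    rw [e, abs_div, abs_of_pos (by positivity : 0 < 2 * u), abs_mul,
      abs_of_pos (by positivity : 0 < u + t),
      div_le_div_iff₀ (mul_pos (abs_pos.2 hne) (by positivity)) (by positivity)]
    have key : t ^ 2 + u ^ 2 ≤ 10 * (|u - t| * (u + t)) := by
      rcases lt_abs.1 h with h' | h'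
      · rw [abs_of_pos (by linarith)]
        nlinarith
      · rw [abs_of_neg (by linarith)]
        nlinarith
    nlinarith
  · rw [zero_add, abs_of_pos (by positivity), inv_eq_one_div,
      div_le_div_iff₀ (by positivity) (by positivity)]
    have := (abs_le.1 (not_lt.1 h)).1
    nlinarith

lemma integrableOn_div_sq_add_sq {u : ℝ} (hu : 0 < u) :
    IntegrableOn (fun t => u / (t ^ 2 + u ^ 2)) (Ioi 0) := by
  have h1 := ((integrable_inv_one_add_sq.comp_mul_left' (inv_ne_zero hu.ne')).const_mul u⁻¹)
  refine (h1.congr (Eventually.of_forall fun t => ?_)).integrableOn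
  simp only
  field_simp
  ring

lemma integral_Ioi_div_sq_add_sq {u : ℝ} (hu : 0 < u) :
    ∫ t in Ioi (0 : ℝ), u / (t ^ 2 + u ^ 2) = π / 2 := by
  have h1 := integral_comp_mul_left_Ioi' (fun x : ℝ => (1 + x ^ 2)⁻¹) 0 (inv_pos.2 hu)
  rw [mul_zero, integral_Ioi_inv_one_add_sq, Real.arctan_zero, sub_zero, smul_eq_mul,
    ← integral_const_mul] at h1
  rw [← h1]
  congr 1
  funext t
  field_simp
  ring

lemma integrable_norm_mul_div_sq_add_sq {h : ℝ → ℂ} (hh : IntegrableOn h (Ioi 0)) :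
    Integrable (fun p : ℝ × ℝ => ‖h p.2‖ * (20 * (p.2 / (p.1 ^ 2 + p.2 ^ 2))))
      ((volume.restrict (Ioi 0)).prod (volume.restrict (Ioi 0))) := by
  rw [integrable_prod_iff']
  · constructor
    · filter_upwards [ae_restrict_mem measurableSet_Ioi] with u hu
      exact ((integrableOn_div_sq_add_sq hu).const_mul _).const_mul _
    · refine (hh.norm.mul_const (10 * π)).congr ?_
      filter_upwards [ae_restrict_mem measurableSet_Ioi] with u hu
      have hu' : 0 < u := hu
      have : ∀ t : ℝ, ‖‖h u‖ * (20 * (u / (t ^ 2 + u ^ 2)))‖ =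
          ‖h u‖ * (20 * (u / (t ^ 2 + u ^ 2))) := fun t => by
        rw [Real.norm_of_nonneg (by positivity)]
      simp only [this]
      rw [integral_const_mul, integral_const_mul, integral_Ioi_div_sq_add_sq hu']
      ring
  · exact (hh.aestronglyMeasurable.norm.comp_snd).mul
      (Measurable.aestronglyMeasurable (by fun_prop))

lemma integrable_mul_tailKernel {h : ℝ → ℂ} (hh : IntegrableOn h (Ioi 0)) :
    Integrable (fun p : ℝ × ℝ => h p.2 * (tailKernel p.1 p.2 : ℂ))
      ((volume.restrict (Ioi 0)).prod (volume.restrict (Ioi 0))) := by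
  refine (integrable_norm_mul_div_sq_add_sq hh).mono' ?_ ?_
  · exact (hh.aestronglyMeasurable.comp_snd).mul
      (Complex.measurable_ofReal.comp measurable_tailKernel).aestronglyMeasurable
  · rw [Measure.prod_restrict]
    filter_upwards [ae_restrict_mem (measurableSet_Ioi.prod measurableSet_Ioi)] with p hp
    rw [norm_mul, Complex.norm_real, Real.norm_eq_abs]
    exact mul_le_mul_of_nonneg_left (abs_tailKernel_le hp.1 hp.2) (norm_nonneg _)

/-- The contribution to the Hilbert transform of `oddExt h` at `t > 0` of the points at distance
more than `t / 2` from `t`. -/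
noncomputable def tailInt (h : ℝ → ℂ) (t : ℝ) : ℂ :=
  ∫ u in Ioi (0 : ℝ), h u * (tailKernel t u : ℂ)

lemma integrableOn_tailInt {h : ℝ → ℂ} (hh : IntegrableOn h (Ioi 0)) :
    IntegrableOn (tailInt h) (Ioi 0) :=
  (integrable_mul_tailKernel hh).integral_prod_left

lemma integral_norm_tailInt_le {h : ℝ → ℂ} (hh : IntegrableOn h (Ioi 0)) :
    ∫ t in Ioi (0 : ℝ), ‖tailInt h t‖ ≤ 10 * π * ∫ t in Ioi (0 : ℝ), ‖h t‖ := by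
  have hD := integrable_norm_mul_div_sq_add_sq hh
  have h1 : ∫ t in Ioi (0 : ℝ), ‖tailInt h t‖ ≤ ∫ t in Ioi (0 : ℝ), ∫ u in Ioi (0 : ℝ),
      ‖h u‖ * (20 * (u / (t ^ 2 + u ^ 2))) := by
    refine integral_mono_ae (integrableOn_tailInt hh).norm hD.integral_prod_left ?_
    filter_upwards [ae_restrict_mem measurableSet_Ioi, hD.prod_right_ae] with t ht hti
    refine norm_integral_le_of_norm_le hti ?_
    filter_upwards [ae_restrict_mem measurableSet_Ioi] with u hu
    rw [norm_mul, Complex.norm_real, Real.norm_eq_abs]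
    exact mul_le_mul_of_nonneg_left (abs_tailKernel_le ht hu) (norm_nonneg _)
  refine h1.trans (le_of_eq ?_)
  rw [integral_integral_swap hD, ← integral_const_mul]
  refine setIntegral_congr_fun measurableSet_Ioi fun u hu => ?_
  rw [integral_const_mul, integral_const_mul, integral_Ioi_div_sq_add_sq hu]
  ring

lemma integral_oddExt_tail {h : ℝ → ℂ} (hh : IntegrableOn h (Ioi 0)) {t : ℝ} (ht : 0 < t) :
    ∫ s in Ioi (t / 2), (oddExt h (t + s) - oddExt h (t - s)) / s = tailInt h t := by
  set g := oddExt h with hgdef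
  have hg : Integrable g := integrable_oddExt hh
  set K : ℝ → ℝ := fun v => if t / 2 < |v - t| then (v - t)⁻¹ else 0 with hK
  have hKm : Measurable K := Measurable.ite (measurableSet_lt (by fun_prop) (by fun_prop))
    (by fun_prop) measurable_const
  have hKb : ∀ v, ‖(K v : ℂ)‖ ≤ 2 / t := fun v => by
    rw [Complex.norm_real, Real.norm_eq_abs]
    simp only [hK]
    split_ifs with h1
    · rw [abs_inv, inv_eq_one_div, div_le_div_iff₀ (by linarith) ht]
      linarith
    · rw [abs_zero]
      positivity
  have hq : Integrable fun v => g v * (K v : ℂ) :=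
    hg.mul_bdd (Complex.measurable_ofReal.comp hKm).aestronglyMeasurable (Eventually.of_forall hKb)
  have e1 := integral_eq_integral_Ioi_neg_add hq
  have e2 := integral_eq_integral_Ioi_neg_add (hq.comp_add_left t)
  rw [integral_add_left_eq_self (fun v => g v * (K v : ℂ)) t, e1] at e2
  have e3 : ∫ u in Ioi (0 : ℝ), (g (-u) * (K (-u) : ℂ) + g u * (K u : ℂ)) = tailInt h t := by
    refine setIntegral_congr_fun measurableSet_Ioi fun u hu => ?_
    have hu' : 0 < u := hu
    have hKn : K (-u) = -(u + t)⁻¹ := by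
      have h1 : |-u - t| = u + t := by
        rw [abs_of_neg (by linarith)]
        ring
      simp only [hK, h1, if_pos (by linarith : t / 2 < u + t)]
      rw [← inv_neg]
      congr 1
      ring
    have hKu : (tailKernel t u : ℂ) = K u + ((u + t : ℝ) : ℂ)⁻¹ := by
      rw [← Complex.ofReal_inv, ← Complex.ofReal_add]
      rfl
    simp only [hgdef, oddExt_neg, oddExt_of_pos h hu', hKn, hKu]
    push_cast
    ring
  rw [← e3, e2, ← integral_indicator measurableSet_Ioi, ← integral_indicator measurableSet_Ioi]
  congr 1
  funext s
  by_cases hs : t / 2 < s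
  · have hs0 : 0 < s := by linarith
    rw [indicator_of_mem (mem_Ioi.2 hs), indicator_of_mem (mem_Ioi.2 hs0)]
    have k1 : K (t + s) = s⁻¹ := by simp [hK, abs_of_pos hs0, hs]
    have k2 : K (t + -s) = -s⁻¹ := by simp [hK, abs_of_pos hs0, hs]
    rw [k1, k2, ← sub_eq_add_neg]
    push_cast
    ring
  · rw [indicator_of_notMem (by simpa using hs)]
    by_cases hs0 : 0 < s
    · rw [indicator_of_mem (mem_Ioi.2 hs0)]
      have k1 : K (t + s) = 0 := by simp [hK, abs_of_pos hs0, hs]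
      have k2 : K (t + -s) = 0 := by simp [hK, abs_of_pos hs0, hs]
      simp [k1, k2]
    · rw [indicator_of_notMem (by simpa using hs0)]

end OddExtension

section TTransform

lemma integrableOn_sub_div {g : ℝ → ℂ} (hg : Integrable g) (x : ℝ) {δ : ℝ} (hδ : 0 < δ) :
    IntegrableOn (fun s : ℝ => (g (x - s) - g (x + s)) / s) (Ioi δ) := by
  have h1 : Integrable fun s => g (x - s) - g (x + s) :=
    (hg.comp_sub_left x).sub (hg.comp_add_left x)
  simp only [div_eq_mul_inv]
  refine Integrable.mul_bdd (c := δ⁻¹) h1.integrableOn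
    (Measurable.aestronglyMeasurable (by fun_prop)) ?_
  filter_upwards [ae_restrict_mem measurableSet_Ioi] with s hs
  have hs' : δ < s := hs
  rw [norm_inv, Complex.norm_real, Real.norm_of_nonneg (by linarith)]
  gcongr

lemma tendsto_integral_oddExt {h : ℝ → ℂ} (hh : IntegrableOn h (Ioi 0)) {t : ℝ} (ht : 0 < t)
    {c : ℂ} (hc : Tendsto (fun δ : ℝ => ∫ s in δ..(t / 2), (h (t + s) - h (t - s)) / (s : ℂ))
      (nhdsWithin 0 (Ioi 0)) (nhds c)) :
    Tendsto (fun δ : ℝ => ∫ s in Ioi δ, (oddExt h (t - s) - oddExt h (t + s)) / s)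
      (nhdsWithin 0 (Ioi 0)) (nhds (-c - tailInt h t)) := by
  refine (hc.neg.sub_const (tailInt h t)).congr' ?_
  filter_upwards [Ioo_mem_nhdsGT (half_pos ht)] with δ hδ
  have hi := integrableOn_sub_div (integrable_oddExt hh) t hδ.1
  rw [← Ioc_union_Ioi_eq_Ioi hδ.2.le, setIntegral_union Ioc_disjoint_Ioi_same measurableSet_Ioi
    (hi.mono_set Ioc_subset_Ioi_self) (hi.mono_set (Ioi_subset_Ioi hδ.2.le)),
    intervalIntegral.integral_of_le hδ.2.le, ← integral_oddExt_tail hh ht, ← integral_neg,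
    sub_eq_add_neg, ← integral_neg]
  congr 1
  · refine setIntegral_congr_fun measurableSet_Ioc fun s hs => ?_
    have h0 : 0 < s := hδ.1.trans hs.1
    have h2 : s ≤ t / 2 := hs.2
    rw [oddExt_of_pos h (by linarith), oddExt_of_pos h (by linarith)]
    ring
  · congr 1
    funext s
    ring

/-- The Hilbert transform (up to normalisation) of the odd extension of `h`, in terms of the
`T`-transform `T` of `h`. -/
noncomputable def hilbertOdd (h T : ℝ → ℂ) (x : ℝ) : ℂ := -T |x| - tailInt h |x|

lemma hilbertOdd_neg (h T : ℝ → ℂ) (x : ℝ) : hilbertOdd h T (-x) = hilbertOdd h T x := by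
  simp [hilbertOdd]

lemma ae_tendsto_integral_oddExt {h T : ℝ → ℂ} (hh : IntegrableOn h (Ioi 0))
    (hT : ∀ t : ℝ, 0 < t →
      Tendsto (fun δ : ℝ => ∫ s in δ..(t / 2), (h (t + s) - h (t - s)) / (s : ℂ))
        (nhdsWithin 0 (Ioi 0)) (nhds (T t))) :
    ∀ᵐ x : ℝ, Tendsto (fun δ : ℝ => ∫ s in Ioi δ, (oddExt h (x - s) - oddExt h (x + s)) / s)
      (nhdsWithin 0 (Ioi 0)) (nhds (hilbertOdd h T x)) := by
  filter_upwards [compl_mem_ae_iff.2 (measure_singleton (0 : ℝ))] with x hx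
  have hx0 : x ≠ 0 := hx
  have key := tendsto_integral_oddExt hh (abs_pos.2 hx0) (hT |x| (abs_pos.2 hx0))
  rcases lt_or_gt_of_ne hx0 with hneg | hpos
  · refine key.congr fun δ => ?_
    congr 1
    funext s
    rw [abs_of_neg hneg, show x - s = -(-x + s) by ring, show x + s = -(-x - s) by ring,
      oddExt_neg, oddExt_neg, neg_sub_neg]
  · rw [abs_of_pos hpos] at key
    rwa [hilbertOdd, abs_of_pos hpos]

lemma integrable_hilbertOdd {h T : ℝ → ℂ} (hh : IntegrableOn h (Ioi 0))
    (hT : IntegrableOn T (Ioi 0)) : Integrable (hilbertOdd h T) := by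
  have h1 : IntegrableOn (hilbertOdd h T) (Ioi 0) := by
    refine (hT.neg.sub (integrableOn_tailInt hh)).congr_fun (fun t ht => ?_) measurableSet_Ioi
    simp [hilbertOdd, abs_of_pos (mem_Ioi.1 ht)]
  exact integrable_of_integrableOn_Ioi h1 (by simpa only [hilbertOdd_neg] using h1)

lemma integral_eq_two_mul_of_even {q : ℝ → ℝ} (hq : ∀ t, q |t| = q t) :
    ∫ t, q t = 2 * ∫ t in Ioi (0 : ℝ), q t := by
  rw [← integral_comp_abs]
  simp only [hq]

/-- The boundary function in the real Hardy space attached to `h` and its `T`-transform `T`. -/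
noncomputable def hardyBoundary (h T : ℝ → ℂ) (x : ℝ) : ℂ :=
  π * oddExt h x + Complex.I * hilbertOdd h T x

lemma integrable_hardyBoundary {h T : ℝ → ℂ} (hh : IntegrableOn h (Ioi 0))
    (hT : IntegrableOn T (Ioi 0)) : Integrable (hardyBoundary h T) :=
  ((integrable_oddExt hh).const_mul _).add ((integrable_hilbertOdd hh hT).const_mul _)

lemma integral_norm_hardyBoundary_le {h T : ℝ → ℂ} (hh : IntegrableOn h (Ioi 0))
    (hT : IntegrableOn T (Ioi 0)) :
    ∫ x, ‖hardyBoundary h T x‖ ≤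
      22 * π * (∫ t in Ioi (0 : ℝ), ‖h t‖) + 2 * ∫ t in Ioi (0 : ℝ), ‖T t‖ := by
  have hg := integrable_oddExt hh
  have hH := integrable_hilbertOdd hh hT
  have hR := integrableOn_tailInt hh
  have h1 : ∫ x, ‖hardyBoundary h T x‖ ≤ ∫ x, (π * ‖oddExt h x‖ + ‖hilbertOdd h T x‖) := by
    refine integral_mono (integrable_hardyBoundary hh hT).norm
      ((hg.norm.const_mul _).add hH.norm) fun x => ?_
    refine (norm_add_le _ _).trans (le_of_eq ?_)
    rw [norm_mul, norm_mul, Complex.norm_I, one_mul, Complex.norm_of_nonneg pi_pos.le]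
  have h2 : ∫ x, ‖oddExt h x‖ = 2 * ∫ t in Ioi (0 : ℝ), ‖h t‖ := by
    rw [integral_eq_two_mul_of_even fun t => ?_]
    · congr 1
      exact setIntegral_congr_fun measurableSet_Ioi fun t ht => by rw [oddExt_of_pos h ht]
    · rcases abs_choice t with ht | ht <;> rw [ht]
      rw [oddExt_neg, norm_neg]
  have h3 : ∫ x, ‖hilbertOdd h T x‖ ≤
      2 * ((∫ t in Ioi (0 : ℝ), ‖T t‖) + ∫ t in Ioi (0 : ℝ), ‖tailInt h t‖) := by
    rw [integral_eq_two_mul_of_even fun t => by simp [hilbertOdd], ← integral_add hT.norm hR.norm]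
    refine mul_le_mul_of_nonneg_left ?_ zero_le_two
    refine setIntegral_mono_on hH.norm.integrableOn (hT.norm.add hR.norm) measurableSet_Ioi
      fun t ht => ?_
    rw [hilbertOdd, abs_of_pos (mem_Ioi.1 ht)]
    refine (norm_sub_le _ _).trans (le_of_eq ?_)
    rw [norm_neg]
  rw [integral_add (hg.norm.const_mul _) hH.norm, integral_const_mul, h2] at h1
  have h4 := integral_norm_tailInt_le hh
  linarith

lemma fourierInt_sub_fourierInt_neg {h T : ℝ → ℂ} (hh : IntegrableOn h (Ioi 0))
    (hT : IntegrableOn T (Ioi 0)) (ξ : ℝ) :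
    fourierInt (hardyBoundary h T) ξ - fourierInt (hardyBoundary h T) (-ξ) =
      -4 * π * Complex.I * ∫ t in Ioi (0 : ℝ), h t * ((Real.sin (ξ * t) : ℝ) : ℂ) := by
  have hF := integrable_hardyBoundary hh hT
  have hi1 := integrable_mul_exp hF ξ
  have hi2 := integrable_mul_exp hF (-ξ)
  have e : ∀ t : ℝ, Complex.exp (-(ξ * t : ℝ) * Complex.I) -
      Complex.exp (-(-ξ * t : ℝ) * Complex.I) = -2 * Complex.I * ((Real.sin (ξ * t) : ℝ) : ℂ) := by
    intro t
    have a1 : (-((-ξ * t : ℝ) : ℂ)) = ((ξ * t : ℝ) : ℂ) := by push_cast; ring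
    rw [a1, Complex.ofReal_sin, Complex.exp_mul_I, Complex.exp_mul_I, Complex.cos_neg,
      Complex.sin_neg]
    ring
  rw [fourierInt, fourierInt, ← integral_sub hi1 hi2, ← integral_const_mul]
  refine (integral_eq_integral_Ioi_neg_add (hi1.sub hi2)).trans ?_
  refine setIntegral_congr_fun measurableSet_Ioi fun t ht => ?_
  simp only [Pi.sub_apply, ← mul_sub, e]
  simp only [mul_neg, Real.sin_neg, Complex.ofReal_neg]
  rw [hardyBoundary, hardyBoundary, oddExt_neg, hilbertOdd_neg, oddExt_of_pos h ht]
  ring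

end TTransform

/-- **Theorem 1 (cosine part).** If `f : (0,∞) → ℂ` is locally absolutely continuous
(with derivative `f'`), of bounded variation, tends to `0` at infinity (so `f'` is
integrable on `(0,∞)`), and the `T`-transform
`Tf'(t) = lim_{δ→0+} ∫_δ^{t/2} (f'(t+s) − f'(t−s))/s ds` is integrable on `(0,∞)`, then
the (improper) cosine Fourier transform `f̂_c(x) = ∫_0^∞ f(t) cos(xt) dt` is Lebesgue
integrable on `(0,∞)`, with
`‖f̂_c‖_{L¹(0,∞)} ≤ C (‖f'‖_{L¹(0,∞)} + ‖Tf'‖_{L¹(0,∞)})` for an absolute constant `C`. -/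
theorem cosine_fourier_transform_integrable_of_T_transform_integrable :
    ∃ C : ℝ, 0 < C ∧
      ∀ (f f' Tf' fc : ℝ → ℂ),
        -- local absolute continuity on (0,∞) with derivative f'
        (∀ a b : ℝ, 0 < a → a ≤ b → f b - f a = ∫ t in a..b, f' t) →
        -- bounded variation on (0,∞)
        BoundedVariationOn f (Set.Ioi 0) →
        -- vanishing at infinity
        Filter.Tendsto f Filter.atTop (nhds 0) →
        -- f' is Lebesgue integrable on (0,∞)
        MeasureTheory.IntegrableOn f' (Set.Ioi 0) →
        -- Tf' is the T-transform of f' (improper/principal value integral)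
        (∀ t : ℝ, 0 < t →
          Filter.Tendsto (fun δ : ℝ => ∫ s in δ..(t / 2), (f' (t + s) - f' (t - s)) / (s : ℂ))
            (nhdsWithin 0 (Set.Ioi 0)) (nhds (Tf' t))) →
        -- Tf' is Lebesgue integrable on (0,∞)
        MeasureTheory.IntegrableOn Tf' (Set.Ioi 0) →
        -- fc is the (improper) cosine Fourier transform of f
        (∀ x : ℝ, 0 < x →
          Filter.Tendsto (fun N : ℝ => ∫ t in (0 : ℝ)..N, f t * (Real.cos (x * t) : ℂ))
            Filter.atTop (nhds (fc x))) →
        MeasureTheory.IntegrableOn fc (Set.Ioi 0) ∧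
          (∫ x in Set.Ioi (0 : ℝ), ‖fc x‖) ≤
            C * ((∫ t in Set.Ioi (0 : ℝ), ‖f' t‖) + ∫ t in Set.Ioi (0 : ℝ), ‖Tf' t‖) := by
  refine ⟨100, by norm_num, fun f h T fc hf _ hlim hh hT hTi hfc => ?_⟩
  set F := hardyBoundary h T with hFdef
  have hF : Integrable F := integrable_hardyBoundary hh hTi
  have hneg : ∀ ξ < 0, fourierInt F ξ = 0 := fun ξ hξ =>
    fourierInt_boundary_eq_zero hF (integrable_oddExt hh)
      (ae_tendsto_cauchyInt (integrable_oddExt hh) (ae_tendsto_integral_oddExt hh hT)) hξ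
  have hval : ∀ ξ ∈ Ioi (0 : ℝ), fc ξ = fourierInt F ξ / (4 * π * Complex.I * ξ) := by
    intro ξ hξ
    have hξ' : 0 < ξ := hξ
    have h1 := fourierInt_sub_fourierInt_neg hh hTi ξ
    rw [← hFdef, hneg (-ξ) (neg_neg_of_pos hξ'), sub_zero] at h1
    rw [cosineTransform_eq hf hlim hh hξ' (hfc ξ hξ'), h1]
    have hξc : (ξ : ℂ) ≠ 0 := by exact_mod_cast hξ'.ne'
    have hπ : (π : ℂ) ≠ 0 := by exact_mod_cast pi_ne_zero
    field_simp [Complex.I_ne_zero]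
  have hnorm : ∀ ξ ∈ Ioi (0 : ℝ), ‖fc ξ‖ = (4 * π)⁻¹ * (‖fourierInt F ξ‖ / ξ) := by
    intro ξ hξ
    have hξ' : 0 < ξ := hξ
    rw [hval ξ hξ, norm_div, norm_mul, norm_mul, norm_mul, Complex.norm_I,
      Complex.norm_of_nonneg pi_pos.le, Complex.norm_of_nonneg hξ'.le, Complex.norm_ofNat]
    field_simp
  have hmeas : AEStronglyMeasurable fc (volume.restrict (Ioi 0)) := by
    have hc := (continuous_fourierInt hF).measurable
    refine AEStronglyMeasurable.congr (f := fun ξ : ℝ => fourierInt F ξ / (4 * π * Complex.I * ξ))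
      (Measurable.aestronglyMeasurable (by fun_prop)) ?_
    filter_upwards [ae_restrict_mem measurableSet_Ioi] with ξ hξ
    exact (hval ξ hξ).symm
  have hmain : ∫⁻ ξ in Ioi (0 : ℝ), ENNReal.ofReal ‖fc ξ‖ ≤
      ENNReal.ofReal ((4 * π)⁻¹ * (16 * ∫ t, ‖F t‖)) := by
    have hc : 0 ≤ (4 * π)⁻¹ := by positivity
    rw [ENNReal.ofReal_mul hc]
    refine le_trans (le_of_eq ?_) (mul_le_mul_right (lintegral_norm_fourierInt_div_le hF hneg) _)
    rw [← lintegral_const_mul' _ _ ENNReal.ofReal_ne_top]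
    refine setLIntegral_congr_fun measurableSet_Ioi fun ξ hξ => ?_
    rw [hnorm ξ hξ, ENNReal.ofReal_mul hc]
  have hFnn : 0 ≤ (4 * π)⁻¹ * (16 * ∫ t, ‖F t‖) := by positivity
  refine ⟨⟨hmeas, ?_⟩, ?_⟩
  · rw [hasFiniteIntegral_iff_norm]
    exact hmain.trans_lt ENNReal.ofReal_lt_top
  · rw [integral_eq_lintegral_of_nonneg_ae (Eventually.of_forall fun _ => norm_nonneg _) hmeas.norm]
    refine (ENNReal.toReal_le_of_le_ofReal hFnn hmain).trans ?_
    have hb := integral_norm_hardyBoundary_le hh hTi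
    have ha : 0 ≤ ∫ t in Ioi (0 : ℝ), ‖h t‖ := by positivity
    have hb' : 0 ≤ ∫ t in Ioi (0 : ℝ), ‖T t‖ := by positivity
    have hπ3 := pi_gt_three
    rw [inv_mul_le_iff₀ (by positivity)]
    nlinarith [mul_nonneg (sub_nonneg.2 hπ3.le) hb', mul_nonneg pi_pos.le ha]
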